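/- Consider min{φ(x) = f(x) + h(x) : Ax = b} under the standing assumptions and let ε > 0 satisfy ε ≤ ‖A‖²/L_f. Choose ρ = L_f/‖A‖², ε_0 = ρ⁻¹, σ = 1/4, γ_p = ε/(2D), γ_d = σ^{3/2}ε/(√3·𝓡), where 𝓡 = R̂_{Λ̃}(1 + √(2ε_0 C))(2/√(1−σ) + 1), R̂_{Λ̃} = max{1, ‖λ̃_* − λ_0‖} with λ̃_* the unique maximizer of the perturbed dual d̃, and C = Σ_{i≥0} B_{i+1} α^i < ∞; and assume α ≤ min{(9/10)(1+√(ργ_d))⁻², (15Dε/(28ε_0))^{√(ρε/D)}}. Then the Inexact Fast ALM (Algorithm 6) finds an ε-primal-dual solution within a number of total ACG iterations bounded by 1 + √(D² + D R̂_Λ)‖A‖/ε + √(D + R̂_Λ)‖A‖/√(L_f ε) + √(D L_f)/√ε, up to a universal constant factor and factors polylogarithmic in the problem parameters, where R̂_Λ = max{1, ‖λ_* − λ_0‖} and λ_* is the minimum-norm maximizer of the dual d. -/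

import Mathlib

noncomputable section

open Set
open scoped RealInnerProductSpace BigOperators

/-- `n`-dimensional Euclidean space. -/
abbrev Euc (k : ℕ) : Type := EuclideanSpace ℝ (Fin k)

variable {n m : ℕ}

/-- `f` is `μ`-strongly convex on the set `s` (with `μ = 0` this is convexity on `s`). -/
def SCOn (s : Set (Euc n)) (mu : ℝ) (f : Euc n → ℝ) : Prop :=
  ∀ ⦃x⦄, x ∈ s → ∀ ⦃y⦄, y ∈ s → ∀ ⦃a c : ℝ⦄, 0 ≤ a → 0 ≤ c → a + c = 1 →
    f (a • x + c • y) ≤ a * f x + c * f y - mu / 2 * (a * c) * ‖x - y‖ ^ 2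

/-- The convex subdifferential of `f` at `x` relative to the domain `s`
(`f` is interpreted as `+∞` outside of `s`). -/
def subdiffOn (s : Set (Euc n)) (f : Euc n → ℝ) (x : Euc n) : Set (Euc n) :=
  {v | ∀ y ∈ s, f x + ⟪v, y - x⟫ ≤ f y}

/-- `p = prox_{η h}(x)`, where `h` is interpreted as `+∞` outside of `s`. -/
def IsProxPt (s : Set (Euc n)) (h : Euc n → ℝ) (eta : ℝ) (x p : Euc n) : Prop :=
  p ∈ s ∧ ∀ ⦃y⦄, y ∈ s → eta * h p + ‖p - x‖ ^ 2 / 2 ≤ eta * h y + ‖y - x‖ ^ 2 / 2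

/-- `f` is differentiable with gradient `f'`, and `f'` is `L`-Lipschitz (i.e. `f` is `L`-smooth). -/
def HasLipGrad (f : Euc n → ℝ) (f' : Euc n → Euc n) (L : ℝ) : Prop :=
  (∀ x, HasGradientAt f (f' x) x) ∧ ∀ x y, ‖f' x - f' y‖ ≤ L * ‖x - y‖
/-- One full run of the ACG method (Algorithm 1) on `ψ = g + h` with parameters `L`, `μ`,
started at `x0 ∈ dom h`.  The minimizations defining `ỹ_{j+1}` are taken over `dom h`
(`h` is interpreted as `+∞` outside of `dom h`). -/
def ACGSpec (domh : Set (Euc n)) (g h : Euc n → ℝ) (g' : Euc n → Euc n) (L mu : ℝ)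
    (x0 : Euc n) (x y xt yt : ℕ → Euc n) (a A tau : ℕ → ℝ) : Prop :=
  A 0 = 0 ∧ tau 0 = 1 ∧ x 0 = x0 ∧ y 0 = x0 ∧ x0 ∈ domh ∧
  (∀ j, a j = (tau j + Real.sqrt (tau j ^ 2 + 8 * tau j * A j * L)) / (4 * L)) ∧
  (∀ j, A (j + 1) = A j + a j) ∧
  (∀ j, tau (j + 1) = tau j + mu * a j) ∧
  (∀ j, xt j = (A j / A (j + 1)) • y j + (a j / A (j + 1)) • x j) ∧
  (∀ j, yt (j + 1) ∈ domh) ∧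
  (∀ j, ∀ u ∈ domh,
      g (xt j) + ⟪g' (xt j), yt (j + 1) - xt j⟫ + h (yt (j + 1)) +
          (2 * L + mu) / 2 * ‖yt (j + 1) - xt j‖ ^ 2 ≤
        g (xt j) + ⟪g' (xt j), u - xt j⟫ + h u +
          (2 * L + mu) / 2 * ‖u - xt j‖ ^ 2) ∧
  (∀ j, (y (j + 1) = y j ∨ y (j + 1) = yt (j + 1)) ∧
      g (y (j + 1)) + h (y (j + 1)) ≤ g (y j) + h (y j) ∧
      g (y (j + 1)) + h (y (j + 1)) ≤ g (yt (j + 1)) + h (yt (j + 1))) ∧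
  (∀ j, x (j + 1) = (A (j + 1) * mu + 1)⁻¹ •
      (((2 * L + mu) * a j) • yt (j + 1) -
        (2 * A j * a j * L / A (j + 1)) • y j))

/-- The aggregate lower model `Θ_j` of the ACG run: `Θ_0 ≡ 0` and
`Θ_{j+1} = (A_j Θ_j + a_j θ_{j+1})/A_{j+1}`, where
`θ_{j+1}(w) = Γ_j(ỹ_{j+1}) - L‖ỹ_{j+1} - x̃_j‖² + ⟪2L(x̃_j - ỹ_{j+1}), w - ỹ_{j+1}⟫ + (μ/2)‖w - ỹ_{j+1}‖²`
and `Γ_j(u) = g(x̃_j) + ⟪∇g(x̃_j), u - x̃_j⟫ + h(u) + ((2L+μ)/2)‖u - x̃_j‖²`. -/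
def ThetaSpec (g h : Euc n → ℝ) (g' : Euc n → Euc n) (L mu : ℝ)
    (xt yt : ℕ → Euc n) (a A : ℕ → ℝ) (Th : ℕ → Euc n → ℝ) : Prop :=
  (∀ w, Th 0 w = 0) ∧
  ∀ j w, Th (j + 1) w =
    (A j * Th j w + a j *
      (g (xt j) + ⟪g' (xt j), yt (j + 1) - xt j⟫ + h (yt (j + 1)) +
          (2 * L + mu) / 2 * ‖yt (j + 1) - xt j‖ ^ 2 -
        L * ‖yt (j + 1) - xt j‖ ^ 2 +
        ⟪(2 * L) • (xt j - yt (j + 1)), w - yt (j + 1)⟫ +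
        mu / 2 * ‖w - yt (j + 1)‖ ^ 2)) / A (j + 1)
/-- The gradient `u ↦ ∇f(u) + Aᵀλ + ρAᵀ(Au - b)` of the smooth part of the augmented
Lagrangian `L_ρ(·,λ)`. -/
def augGrad (f' : Euc n → Euc n) (A : Euc n →L[ℝ] Euc m) (bvec : Euc m)
    (rho : ℝ) (lam : Euc m) (u : Euc n) : Euc n :=
  f' u + (ContinuousLinearMap.adjoint A) lam +
    rho • (ContinuousLinearMap.adjoint A) (A u - bvec)
/-- The tolerance `ε_k = (7ε₀αᵏ + σρε²)/8` of the I-FALM. -/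
def epsFALM (eps0 alpha sigma rho eps : ℝ) (k : ℕ) : ℝ :=
  (7 * eps0 * alpha ^ k + sigma * rho * eps ^ 2) / 8

/-- A full run of the Inexact Fast Augmented Lagrangian Method (Algorithm 6) on
`min {f + h : Ax = b}`, with primal perturbation `(γ_p/2)‖· - x₀‖²` centered at
`x0c = x_0` and dual perturbation `(γ_d/2)‖· - λ₀‖²` centered at `λ₀ = 0`.
At iteration `k`, ACG is run on `ψ = L̃_ρ(·,ν̃_k) + (ε_k/(8D²))‖· - x_k‖²` (with
`L = M_ρ = L_f + ρ‖A‖²` and `μ = γ_p + ε_k/(4D²)`) from `x_k`; `P k j` is the prox point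
and `Gm k j` the gradient mapping of `L̃_ρ(·,ν̃_k)` (stepsize `(2L+μ)⁻¹`) at the inner
iterate `x̃_j`; the call is stopped at the first `J k` with `‖Gm k (J k)‖ ≤ ε_k/(2D)`;
then `x_{k+1} = x̃_{J k} - (2L+μ)⁻¹ Gm k (J k)`, `λ_{k+1} = ν̃_k + ρ(Ax_{k+1} - b)`, and
`ν_{k+1} = (τ_k ν_k + b_k γ_d λ_{k+1}/(1+γ_dρ) - (b_k/ρ)(ν̃_k - λ_{k+1}/(1+γ_dρ)))/τ_{k+1}`. -/
def FALMSpec (domh : Set (Euc n)) (f h : Euc n → ℝ) (f' : Euc n → Euc n)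
    (A : Euc n →L[ℝ] Euc m) (bvec : Euc m)
    (Lf D rho eps eps0 alpha sigma gp gd : ℝ) (x0c : Euc n)
    (xseq : ℕ → Euc n) (lamseq nu nut : ℕ → Euc m) (bo Bo tauo : ℕ → ℝ)
    (xin yin xtin ytin : ℕ → ℕ → Euc n) (ain Ain tauin : ℕ → ℕ → ℝ)
    (P Gm : ℕ → ℕ → Euc n) (J : ℕ → ℕ) : Prop :=
  Bo 0 = 0 ∧ tauo 0 = 1 ∧ lamseq 0 = 0 ∧ nu 0 = 0 ∧ x0c = xseq 0 ∧
  (∀ k, bo k = (rho * tauo k +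
      Real.sqrt (rho ^ 2 * tauo k ^ 2 + 4 * rho * tauo k * Bo k)) / 2) ∧
  (∀ k, Bo (k + 1) = Bo k + bo k) ∧
  (∀ k, tauo (k + 1) = tauo k + bo k * gd) ∧
  (∀ k, nut k = (Bo k / Bo (k + 1)) • lamseq k + (bo k / Bo (k + 1)) • nu k) ∧
  -- inner ACG runs on the doubly perturbed augmented Lagrangian plus proximal term
  (∀ k, ACGSpec domh
      (fun u => f u + gp / 2 * ‖u - x0c‖ ^ 2 + ⟪nut k, A u - bvec⟫ +
        rho / 2 * ‖A u - bvec‖ ^ 2 - gd / 2 * ‖nut k‖ ^ 2 +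
        epsFALM eps0 alpha sigma rho eps k / (8 * D ^ 2) * ‖u - xseq k‖ ^ 2)
      h
      (fun u => augGrad f' A bvec rho (nut k) u + gp • (u - x0c) +
        (epsFALM eps0 alpha sigma rho eps k / (4 * D ^ 2)) • (u - xseq k))
      (Lf + rho * ‖A‖ ^ 2)
      (gp + epsFALM eps0 alpha sigma rho eps k / (4 * D ^ 2))
      (xseq k) (xin k) (yin k) (xtin k) (ytin k) (ain k) (Ain k) (tauin k)) ∧
  -- prox points and gradient mapping of `L̃_ρ(·,ν̃_k)` at the inner iterates `x̃_j`
  (∀ k j, IsProxPt domh h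
      (2 * (Lf + rho * ‖A‖ ^ 2) +
        (gp + epsFALM eps0 alpha sigma rho eps k / (4 * D ^ 2)))⁻¹
      (xtin k j -
        (2 * (Lf + rho * ‖A‖ ^ 2) +
          (gp + epsFALM eps0 alpha sigma rho eps k / (4 * D ^ 2)))⁻¹ •
          (augGrad f' A bvec rho (nut k) (xtin k j) + gp • (xtin k j - x0c)))
      (P k j)) ∧
  (∀ k j, Gm k j =
      (2 * (Lf + rho * ‖A‖ ^ 2) +
        (gp + epsFALM eps0 alpha sigma rho eps k / (4 * D ^ 2))) •
        (xtin k j - P k j)) ∧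
  (∀ k, ‖Gm k (J k)‖ ≤ epsFALM eps0 alpha sigma rho eps k / (2 * D)) ∧
  (∀ k j, j < J k → ¬(‖Gm k j‖ ≤ epsFALM eps0 alpha sigma rho eps k / (2 * D))) ∧
  (∀ k, xseq (k + 1) = xtin k (J k) -
      (2 * (Lf + rho * ‖A‖ ^ 2) +
        (gp + epsFALM eps0 alpha sigma rho eps k / (4 * D ^ 2)))⁻¹ • Gm k (J k)) ∧
  (∀ k, lamseq (k + 1) = nut k + rho • (A (xseq (k + 1)) - bvec)) ∧
  (∀ k, nu (k + 1) = (tauo (k + 1))⁻¹ •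
      (tauo k • nu k + (bo k * gd / (1 + gd * rho)) • lamseq (k + 1) -
        (bo k / rho) • (nut k - (1 + gd * rho)⁻¹ • lamseq (k + 1))))
/-! ### Convex-analysis helpers -/

lemma prox_opt {s : Set (Euc n)} {h : Euc n → ℝ} (hh : ConvexOn ℝ s h) (ka : ℝ)
    (p x y : Euc n) (hy : y ∈ s)
    (hmin : ∀ u ∈ s, ⟪p, y⟫ + h y + ka / 2 * ‖y - x‖ ^ 2 ≤
      ⟪p, u⟫ + h u + ka / 2 * ‖u - x‖ ^ 2) :
    ∀ w ∈ s, h y + ⟪ka • (x - y) - p, w - y⟫ ≤ h w := by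
  intro w hw
  by_contra hcon
  push Not at hcon
  set δ : ℝ := h y + ⟪ka • (x - y) - p, w - y⟫ - h w with hδ
  have hδ0 : 0 < δ := by rw [hδ]; linarith
  set q : ℝ := ka / 2 * ‖w - y‖ ^ 2 with hq
  have key : ∀ t : ℝ, 0 < t → t ≤ 1 → δ ≤ t * q := by
    intro t ht ht1
    have hmem : (1 - t) • y + t • w ∈ s := hh.1 hy hw (by linarith) ht.le (by ring)
    have hc := hh.2 hy hw (show (0:ℝ) ≤ 1 - t by linarith) ht.le (by ring)
    have hm := hmin _ hmem
    simp only [smul_eq_mul] at hc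
    have e1 : (1 - t) • y + t • w - x = (y - x) + t • (w - y) := by
      module
    have e2 : (1 - t) • y + t • w = y + t • (w - y) := by module
    have e3 : ‖(1 - t) • y + t • w - x‖ ^ 2 =
        ‖y - x‖ ^ 2 + 2 * (t * ⟪y - x, w - y⟫) + t ^ 2 * ‖w - y‖ ^ 2 := by
      rw [e1, norm_add_sq_real, inner_smul_right, norm_smul, mul_pow]
      simp
    have e4 : ⟪p, (1 - t) • y + t • w⟫ = ⟪p, y⟫ + t * ⟪p, w - y⟫ := by
      rw [e2, inner_add_right, inner_smul_right]
    rw [e3, e4] at hm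
    have e5 : ⟪ka • (x - y) - p, w - y⟫ = - ka * ⟪y - x, w - y⟫ - ⟪p, w - y⟫ := by
      rw [inner_sub_left, inner_smul_left, ← neg_sub y x, inner_neg_left]; simp
    have : t * δ ≤ t * (t * q) := by
      rw [hδ, hq, e5]; nlinarith
    exact le_of_mul_le_mul_left this ht
  have h1 := key 1 one_pos le_rfl
  have hqpos : 0 < q := by linarith
  have h2 := key (δ / (2 * q)) (by positivity) (by rw [div_le_one (by positivity)]; linarith)
  have : δ / (2 * q) * q = δ / 2 := by field_simp
  linarith

lemma line_hasDeriv {f : Euc n → ℝ} {f' : Euc n → Euc n}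
    (hf : ∀ x, HasGradientAt f (f' x) x) (x v : Euc n) (t : ℝ) :
    HasDerivAt (fun t : ℝ => f (x + t • v)) ⟪f' (x + t • v), v⟫ t := by
  have h1 : HasFDerivAt f _ (x + t • v) := (hf (x + t • v)).hasFDerivAt
  have h2 : HasDerivAt (fun t : ℝ => x + t • v) v t := by
    simpa using ((hasDerivAt_id t).smul_const v).const_add x
  have h3 := h1.comp_hasDerivAt t h2
  have e : ((InnerProductSpace.toDual ℝ (Euc n)) (f' (x + t • v))) v = ⟪f' (x + t • v), v⟫ := by
    simp
  rw [← e]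
  exact h3

lemma descent {f : Euc n → ℝ} {f' : Euc n → Euc n} {L : ℝ} (hf : HasLipGrad f f' L)
    (x y : Euc n) : f y ≤ f x + ⟪f' x, y - x⟫ + L / 2 * ‖y - x‖ ^ 2 := by
  set v := y - x with hv
  have hd : ∀ t : ℝ, HasDerivAt
      (fun t : ℝ => f (x + t • v) - (t * ⟪f' x, v⟫ + L / 2 * ‖v‖ ^ 2 * t ^ 2))
      (⟪f' (x + t • v), v⟫ - (⟪f' x, v⟫ + L / 2 * ‖v‖ ^ 2 * (2 * t))) t := by
    intro t
    refine (line_hasDeriv hf.1 x v t).sub (HasDerivAt.add ?_ ?_)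
    · simpa using (hasDerivAt_id t).mul_const ⟪f' x, v⟫
    · simpa using ((hasDerivAt_pow 2 t).const_mul (L / 2 * ‖v‖ ^ 2))
  have hanti : AntitoneOn
      (fun t : ℝ => f (x + t • v) - (t * ⟪f' x, v⟫ + L / 2 * ‖v‖ ^ 2 * t ^ 2)) (Icc 0 1) := by
    refine antitoneOn_of_deriv_nonpos (convex_Icc 0 1)
      (fun t _ => (hd t).continuousAt.continuousWithinAt)
      (fun t _ => (hd t).differentiableAt.differentiableWithinAt) ?_
    intro t ht
    rw [interior_Icc] at ht
    rw [(hd t).deriv]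
    have h1 := hf.2 (x + t • v) x
    have h2 : ⟪f' (x + t • v) - f' x, v⟫ ≤ ‖f' (x + t • v) - f' x‖ * ‖v‖ :=
      real_inner_le_norm _ _
    rw [inner_sub_left] at h2
    have h3 : ‖x + t • v - x‖ = t * ‖v‖ := by
      rw [add_sub_cancel_left, norm_smul, Real.norm_of_nonneg ht.1.le]
    rw [h3] at h1
    have h4 := mul_le_mul_of_nonneg_right h1 (norm_nonneg v)
    nlinarith
  have := hanti (left_mem_Icc.2 zero_le_one) (right_mem_Icc.2 zero_le_one) zero_le_one
  simp only [one_smul, zero_smul, add_zero] at this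
  have e : x + v = y := by rw [hv]; abel
  rw [e] at this
  simp at this
  linarith

lemma convex_lower {f : Euc n → ℝ} {f' : Euc n → Euc n}
    (hf : ∀ x, HasGradientAt f (f' x) x) (hc : ConvexOn ℝ Set.univ f)
    (x y : Euc n) : f x + ⟪f' x, y - x⟫ ≤ f y := by
  set v := y - x with hv
  have hc1 : ConvexOn ℝ Set.univ (fun t : ℝ => f (x + t • v)) := by
    refine ⟨convex_univ, fun s _ t _ a b ha hb hab => ?_⟩
    have := hc.2 (mem_univ (x + s • v)) (mem_univ (x + t • v)) ha hb hab
    have e : x + (a • s + b • t) • v = a • (x + s • v) + b • (x + t • v) := by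
      have : x = (a + b) • x := by rw [hab, one_smul]
      nth_rewrite 1 [this]
      simp only [smul_eq_mul]
      module
    show f (x + (a • s + b • t) • v) ≤ _
    rw [e]; exact this
  have h0 := line_hasDeriv hf x v 0
  have := hc1.le_slope_of_hasDerivAt (mem_univ 0) (mem_univ 1) zero_lt_one h0
  simp [slope_def_field] at this
  have e : x + v = y := by rw [hv]; abel
  rw [e] at this
  linarith

/-! ### One ACG step -/

lemma acg_step {E : Type*} [NormedAddCommGroup E] [InnerProductSpace ℝ E]
    (y x z yt xt xp : E) (A a A' tau tau' mu L : ℝ)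
    (hA : 0 ≤ A) (ha : 0 < a) (hmu : 0 ≤ mu) (hL : 0 < L) (htau : 0 < tau)
    (hA' : A' = A + a) (htau' : tau' = tau + mu * a)
    (hq : 2 * L * a ^ 2 = tau * A')
    (hxt : A' • xt = A • y + a • x)
    (hxp : tau' • xp = tau • x - (2 * L * a) • xt + ((2 * L + mu) * a) • yt) :
    A' * (L / 2 * ‖yt - xt‖ ^ 2)
      - A * (⟪(2 * L) • (xt - yt), y - yt⟫ + mu / 2 * ‖y - yt‖ ^ 2)
      - a * (⟪(2 * L) • (xt - yt), z - yt⟫ + mu / 2 * ‖z - yt‖ ^ 2)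
      + tau' / 2 * ‖xp - z‖ ^ 2 - tau / 2 * ‖x - z‖ ^ 2
    ≤ - (A' * L / 2 * ‖yt - xt‖ ^ 2) := by
  -- shift coordinates by `xp`
  have hG : (a * (2 * L)) • (xt - yt) = tau • (x - xp) + (a * mu) • (yt - xp) := by
    have : (0 : E) = tau' • xp - (tau • x - (2 * L * a) • xt + ((2 * L + mu) * a) • yt) := by
      rw [hxp]; simp
    have h2 : (a * (2 * L)) • (xt - yt) - (tau • (x - xp) + (a * mu) • (yt - xp))
        = tau' • xp - (tau • x - (2 * L * a) • xt + ((2 * L + mu) * a) • yt) := by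
      rw [htau']; module
    rw [← sub_eq_zero, h2, ← this]
  have i1 : a * (2 * L) * ⟪xt - yt, z - xp⟫ =
      tau * ⟪x - xp, z - xp⟫ + a * mu * ⟪yt - xp, z - xp⟫ := by
    have := congrArg (fun w => ⟪w, z - xp⟫) hG
    simpa only [inner_add_left, real_inner_smul_left] using this
  have n1 : ‖x - z‖ ^ 2 = ‖x - xp‖ ^ 2 - 2 * ⟪x - xp, z - xp⟫ + ‖xp - z‖ ^ 2 := by
    rw [norm_sub_rev xp z, ← norm_sub_sq_real]; congr 2; abel
  have n2 : ‖z - yt‖ ^ 2 = ‖yt - xp‖ ^ 2 - 2 * ⟪yt - xp, z - xp⟫ + ‖xp - z‖ ^ 2 := by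
    rw [norm_sub_rev xp z, norm_sub_rev z yt, ← norm_sub_sq_real]; congr 2; abel
  have i2 : ⟪xt - yt, z - yt⟫ = ⟪xt - yt, z - xp⟫ + ⟪xt - yt, xp - yt⟫ := by
    rw [← inner_add_right]; congr 1; abel
  have i3 : A * ⟪xt - yt, y - yt⟫ + a * ⟪xt - yt, xp - yt⟫ =
      A' * ‖yt - xt‖ ^ 2 - a * ⟪xt - yt, x - xp⟫ := by
    have hv : A • (y - yt) + a • (xp - yt) = A' • (xt - yt) - a • (x - xp) := by
      rw [smul_sub A', hxt, hA']; module
    have := congrArg (fun w => ⟪xt - yt, w⟫) hv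
    simp only [inner_add_right, inner_sub_right _ (A' • _), inner_smul_right] at this
    rw [real_inner_self_eq_norm_sq, norm_sub_rev xt yt] at this
    exact this
  have cs : ⟪xt - yt, x - xp⟫ ≤ ‖yt - xt‖ * ‖x - xp‖ := by
    rw [norm_sub_rev yt xt]; exact real_inner_le_norm _ _
  simp only [inner_smul_left, RCLike.conj_to_real]
  set U := ‖yt - xt‖
  set V := ‖x - xp‖
  have hU : 0 ≤ U := norm_nonneg _
  have hV : 0 ≤ V := norm_nonneg _
  have y0 := norm_nonneg (y - yt)
  have y1 := norm_nonneg (yt - xp)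
  -- Young
  have yg : 2 * L * a * (U * V) ≤ L * A' * U ^ 2 + tau / 2 * V ^ 2 := by
    have h1 : 0 ≤ (2 * L * a * U - tau * V) ^ 2 := sq_nonneg _
    have h2 : tau * (2 * L * a * (U * V)) ≤ tau * (L * A' * U ^ 2 + tau / 2 * V ^ 2) := by
      have : (2 * L * a * U) ^ 2 = 2 * L * U ^ 2 * (tau * A') := by rw [← hq]; ring
      nlinarith
    exact le_of_mul_le_mul_left h2 htau
  have m1 : 0 ≤ A * (mu / 2 * ‖y - yt‖ ^ 2) := by positivity
  have m2 : 0 ≤ a * mu / 2 * ‖yt - xp‖ ^ 2 := by positivity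
  have cs2 := mul_le_mul_of_nonneg_left cs (show 0 ≤ 2 * L * a by positivity)
  have i3' := congrArg (fun w => 2 * L * w) i3
  rw [n1, n2, i2, htau']
  nlinarith
/-! ### Growth of the step-size sequences -/

lemma quad_root {ka tau B b : ℝ} (hk : 0 < ka) (ht : 0 < tau) (hB : 0 ≤ B)
    (hb : b = (ka * tau + Real.sqrt (ka ^ 2 * tau ^ 2 + 4 * ka * tau * B)) / 2) :
    0 < b ∧ b ^ 2 = ka * tau * (B + b) := by
  have h0 : 0 ≤ ka ^ 2 * tau ^ 2 + 4 * ka * tau * B := by positivity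
  have hs := Real.sq_sqrt h0
  have hs0 := Real.sqrt_nonneg (ka ^ 2 * tau ^ 2 + 4 * ka * tau * B)
  set S := Real.sqrt (ka ^ 2 * tau ^ 2 + 4 * ka * tau * B)
  constructor
  · rw [hb]; have : 0 < ka * tau := by positivity
    linarith
  · rw [hb]; nlinarith

lemma seq_basic {ka ga : ℝ} (hk : 0 < ka) (hg : 0 ≤ ga) {B b tau : ℕ → ℝ}
    (hB0 : B 0 = 0) (ht0 : tau 0 = 1)
    (hb : ∀ k, b k = (ka * tau k +
      Real.sqrt (ka ^ 2 * tau k ^ 2 + 4 * ka * tau k * B k)) / 2)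
    (hB : ∀ k, B (k + 1) = B k + b k) (ht : ∀ k, tau (k + 1) = tau k + ga * b k) :
    ∀ k, 0 ≤ B k ∧ tau k = 1 + ga * B k ∧ 0 < b k ∧ b k ^ 2 = ka * tau k * B (k + 1) := by
  have h1 : ∀ k, 0 ≤ B k ∧ tau k = 1 + ga * B k := by
    intro k
    induction k with
    | zero => simp [hB0, ht0]
    | succ k ih =>
      obtain ⟨i1, i2⟩ := ih
      have hpos : 0 < tau k := by rw [i2]; positivity
      have := (quad_root hk hpos i1 (hb k)).1
      refine ⟨by rw [hB]; linarith, ?_⟩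
      rw [ht, hB, i2]; ring
  intro k
  obtain ⟨i1, i2⟩ := h1 k
  have hpos : 0 < tau k := by rw [i2]; positivity
  have := quad_root hk hpos i1 (hb k)
  refine ⟨i1, i2, this.1, ?_⟩
  rw [hB]; exact this.2

lemma seq_first {ka ga : ℝ} {B b tau : ℕ → ℝ}
    (hB0 : B 0 = 0) (hB : ∀ k, B (k + 1) = B k + b k)
    (h : ∀ k, 0 ≤ B k ∧ tau k = 1 + ga * B k ∧ 0 < b k ∧ b k ^ 2 = ka * tau k * B (k + 1)) :
    B 1 = ka := by
  obtain ⟨_, h2, h3, h4⟩ := h 0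
  have e : B 1 = b 0 := by have := hB 0; simp only [zero_add] at this; rw [this, hB0]; ring
  simp only [zero_add] at h4
  rw [h2, hB0, e] at h4
  have : b 0 * (b 0 - ka) = 0 := by linarith
  rcases mul_eq_zero.1 this with h | h
  · linarith
  · rw [e]; linarith

lemma seq_growth {ka ga : ℝ} (hk : 0 < ka) (hg : 0 ≤ ga) {B b tau : ℕ → ℝ}
    (hB0 : B 0 = 0) (hB : ∀ k, B (k + 1) = B k + b k)
    (h : ∀ k, 0 ≤ B k ∧ tau k = 1 + ga * B k ∧ 0 < b k ∧ b k ^ 2 = ka * tau k * B (k + 1)) :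
    ∀ k, ka * ((1 + Real.sqrt (ka * ga) / 2) ^ k) ^ 2 ≤ B (k + 1) ∧
      B (k + 1) ≤ ka * ((k + 1) * (1 + Real.sqrt (ka * ga)) ^ k) ^ 2 := by
  have hfirst := seq_first hB0 hB h
  set q := Real.sqrt (ka * ga) with hq
  have hq0 : 0 ≤ q := Real.sqrt_nonneg _
  have hq2 : q ^ 2 = ka * ga := Real.sq_sqrt (by positivity)
  set r := Real.sqrt ka with hr
  have hr0 : 0 < r := Real.sqrt_pos.2 hk
  have hr2 : r ^ 2 = ka := Real.sq_sqrt hk.le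
  have step : ∀ k, Real.sqrt (B k) * (1 + q / 2) ≤ Real.sqrt (B (k + 1)) ∧
      Real.sqrt (B (k + 1)) ≤ (1 + q) * Real.sqrt (B k) + r := by
    intro k
    obtain ⟨h1, h2, h3, h4⟩ := h k
    have h1' := (h (k + 1)).1
    have hpos : 0 < B (k + 1) := by rw [hB]; linarith
    have e1 := Real.sq_sqrt h1
    have e2 := Real.sq_sqrt h1'
    have s0 := Real.sqrt_nonneg (B k)
    have s1 : 0 < Real.sqrt (B (k + 1)) := Real.sqrt_pos.2 hpos
    set S := Real.sqrt (B k)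
    set S' := Real.sqrt (B (k + 1))
    have e3 : S' ^ 2 = S ^ 2 + b k := by rw [e1, e2, hB]
    have e4 : b k ^ 2 = (ka + q ^ 2 * S ^ 2) * S' ^ 2 := by
      rw [h4, h2, e1, e2, hq2]; ring
    have lo : q * S * S' ≤ b k := by
      refine le_of_sq_le_sq ?_ h3.le
      rw [e4]; nlinarith [mul_pos hk (pow_pos s1 2)]
    have hi : b k ≤ (r + q * S) * S' := by
      refine le_of_sq_le_sq ?_ (by positivity)
      rw [e4, ← hr2, mul_pow]
      have : 0 ≤ 2 * r * (q * S) := by positivity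
      have := mul_nonneg this (sq_nonneg S')
      nlinarith
    constructor
    · by_contra hc
      push Not at hc
      have hge : S ≤ S' := le_of_sq_le_sq (by rw [e3]; linarith) s1.le
      have : S ^ 2 ≤ S' * (S' - q * S) := by nlinarith
      by_cases hn : S' - q * S ≤ 0
      · have : S ^ 2 ≤ 0 := by nlinarith
        have : S = 0 := by nlinarith
        rw [this] at hc; simp at hc; linarith
      · push Not at hn
        have a1 : S' * (S' - q * S) < (S * (1 + q / 2)) * (S' - q * S) :=
          mul_lt_mul_of_pos_right hc hn
        have a2 : (S * (1 + q / 2)) * (S' - q * S) ≤ (S * (1 + q / 2)) * (S - q / 2 * S) :=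
          mul_le_mul_of_nonneg_left (by linarith) (by positivity)
        nlinarith [mul_nonneg (sq_nonneg q) (sq_nonneg S)]
    · have hge : S ≤ S' := le_of_sq_le_sq (by rw [e3]; linarith) s1.le
      have : S' * S' ≤ S' * ((1 + q) * S + r) := by nlinarith
      exact le_of_mul_le_mul_left this s1
  have hall : ∀ k : ℕ, r * (1 + q / 2) ^ k ≤ Real.sqrt (B (k + 1)) ∧
      Real.sqrt (B (k + 1)) ≤ r * ((k + 1) * (1 + q) ^ k) := by
    intro k
    induction k with
    | zero => simp [hfirst, hr]
    | succ k ih =>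
      obtain ⟨s1, s2⟩ := step (k + 1)
      constructor
      · calc r * (1 + q / 2) ^ (k + 1) = (r * (1 + q / 2) ^ k) * (1 + q / 2) := by ring
          _ ≤ _ := mul_le_mul_of_nonneg_right ih.1 (by positivity)
          _ ≤ _ := s1
      · have h1 : 1 ≤ (1 + q) ^ (k + 1) := one_le_pow₀ (by linarith)
        have h2 := mul_le_mul_of_nonneg_left ih.2 (show 0 ≤ 1 + q by linarith)
        push_cast
        have e : (1 + q) * (r * ((k + 1) * (1 + q) ^ k)) = r * ((k + 1) * (1 + q) ^ (k + 1)) := by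
          ring
        rw [e] at h2
        nlinarith
  intro k
  obtain ⟨a1, a2⟩ := hall k
  have e := Real.sq_sqrt (h (k + 1)).1
  constructor
  · rw [← e, ← hr2, ← mul_pow]
    exact pow_le_pow_left₀ (by positivity) a1 2
  · rw [← e, ← hr2, ← mul_pow]
    exact pow_le_pow_left₀ (Real.sqrt_nonneg _) a2 2

/-! ### ACG convergence -/

lemma acg_seq {domh : Set (Euc n)} {g h : Euc n → ℝ} {g' : Euc n → Euc n} {L mu : ℝ}
    {x0 : Euc n} {x y xt yt : ℕ → Euc n} {a A tau : ℕ → ℝ}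
    (hs : ACGSpec domh g h g' L mu x0 x y xt yt a A tau) (hL : 0 < L) (hmu : 0 ≤ mu) :
    ∀ k, 0 ≤ A k ∧ tau k = 1 + mu * A k ∧ 0 < a k ∧
      a k ^ 2 = (2 * L)⁻¹ * tau k * A (k + 1) := by
  obtain ⟨hA0, ht0, -, -, -, ha, hA, ht, -⟩ := hs
  have hk : 0 < (2 * L)⁻¹ := by positivity
  refine seq_basic hk hmu hA0 ht0 ?_ hA ht
  intro k
  rw [ha k]
  have e : (2 * L)⁻¹ ^ 2 * tau k ^ 2 + 4 * (2 * L)⁻¹ * tau k * A k =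
      (2 * L)⁻¹ ^ 2 * (tau k ^ 2 + 8 * tau k * A k * L) := by
    field_simp; ring
  rw [e, Real.sqrt_mul (by positivity), Real.sqrt_sq hk.le]
  field_simp; ring

lemma acg_bound {domh : Set (Euc n)} {g h : Euc n → ℝ} {g' : Euc n → Euc n} {L mu D : ℝ}
    {x0 : Euc n} {x y xt yt : ℕ → Euc n} {a A tau : ℕ → ℝ}
    (hs : ACGSpec domh g h g' L mu x0 x y xt yt a A tau) (hL : 0 < L) (hmu : 0 ≤ mu)
    (hh : ConvexOn ℝ domh h)
    (hlow : ∀ u w, g u + ⟪g' u, w - u⟫ + mu / 2 * ‖w - u‖ ^ 2 ≤ g w)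
    (hup : ∀ u w, g w ≤ g u + ⟪g' u, w - u⟫ + (L + mu) / 2 * ‖w - u‖ ^ 2)
    (xs : Euc n) (hxs : xs ∈ domh) (hmin : ∀ w ∈ domh, g xs + h xs ≤ g w + h w)
    (hD : ‖x0 - xs‖ ≤ D) :
    ∀ j, L * A (j + 1) * ‖yt (j + 1) - xt j‖ ^ 2 ≤ D ^ 2 := by
  have hseq := acg_seq hs hL hmu
  obtain ⟨hA0, ht0, hx0, hy0, hx0d, ha, hA, ht, hxt, hytd, hytmin, hy, hx⟩ := hs
  have hyd : ∀ j, y j ∈ domh := by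
    intro j
    induction j with
    | zero => rw [hy0]; exact hx0d
    | succ j ih =>
      rcases (hy j).1 with h | h
      · rw [h]; exact ih
      · rw [h]; exact hytd j
  set E : ℕ → ℝ := fun j => A j * (g (y j) + h (y j) - (g xs + h xs)) +
    tau j / 2 * ‖x j - xs‖ ^ 2 with hE
  have step : ∀ j, E (j + 1) + A (j + 1) * L / 2 * ‖yt (j + 1) - xt j‖ ^ 2 ≤ E j := by
    intro j
    obtain ⟨q1, q2, q3, q4⟩ := hseq j
    have htau : 0 < tau j := by rw [q2]; positivity
    have hAp : 0 < A (j + 1) := by rw [hA]; linarith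
    have hopt := prox_opt hh (2 * L + mu) (g' (xt j)) (xt j) (yt (j + 1)) (hytd j) (by
      intro u hu
      have := hytmin j u hu
      rw [inner_sub_right, inner_sub_right] at this
      linarith)
    -- lower model
    have hth : ∀ w ∈ domh, g (xt j) + ⟪g' (xt j), yt (j + 1) - xt j⟫ +
        mu / 2 * ‖yt (j + 1) - xt j‖ ^ 2 + h (yt (j + 1)) +
        ⟪(2 * L) • (xt j - yt (j + 1)), w - yt (j + 1)⟫ +
        mu / 2 * ‖w - yt (j + 1)‖ ^ 2 ≤ g w + h w := by
      intro w hw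
      have h1 := hopt w hw
      have h2 := hlow (xt j) w
      rw [inner_sub_left, add_smul, inner_add_left, real_inner_smul_left _ _ mu] at h1
      have e1 : ⟪g' (xt j), w - xt j⟫ = ⟪g' (xt j), w - yt (j + 1)⟫ +
          ⟪g' (xt j), yt (j + 1) - xt j⟫ := by
        rw [← inner_add_right]; congr 1; abel
      have e2 : ‖w - xt j‖ ^ 2 = ‖w - yt (j + 1)‖ ^ 2 -
          2 * ⟪xt j - yt (j + 1), w - yt (j + 1)⟫ + ‖yt (j + 1) - xt j‖ ^ 2 := by
        rw [norm_sub_rev (yt (j + 1)), real_inner_comm, ← norm_sub_sq_real]; congr 2; abel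
      rw [e1, e2] at h2
      linarith
    have l1 := hth (y j) (hyd j)
    have l2 := hth xs hxs
    have u1 := (hy j).2.2
    have u2 := hup (xt j) (yt (j + 1))
    have st := acg_step (y j) (x j) xs (yt (j + 1)) (xt j) (x (j + 1)) (A j) (a j) (A (j + 1))
      (tau j) (tau (j + 1)) mu L q1 q3 hmu hL htau (hA j) (ht j)
      (by rw [q4]; field_simp)
      (by rw [hxt, smul_add, smul_smul, smul_smul]; congr 2 <;> field_simp)
      (by
        have e : tau (j + 1) = A (j + 1) * mu + 1 := by rw [(hseq (j + 1)).2.1]; ring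
        have hne : A (j + 1) * mu + 1 ≠ 0 := by positivity
        rw [hx, e, smul_smul, mul_inv_cancel₀ hne, one_smul, hxt, smul_add, smul_smul, smul_smul]
        have e2 : 2 * L * a j * (a j / A (j + 1)) = tau j := by
          have : 2 * L * a j ^ 2 = tau j * A (j + 1) := by rw [q4]; field_simp
          field_simp; linarith
        have e3 : 2 * L * a j * (A j / A (j + 1)) = 2 * A j * a j * L / A (j + 1) := by ring
        rw [e2, e3]; module)
    have l1' := mul_le_mul_of_nonneg_left l1 q1
    have l2' := mul_le_mul_of_nonneg_left l2 q3.le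
    have u' := mul_le_mul_of_nonneg_left (u1.trans (add_le_add_left u2 _)) hAp.le
    simp only [hE]
    rw [hA] at *
    nlinarith
  have hE0 : E 0 ≤ D ^ 2 / 2 := by
    simp only [hE, hA0, ht0, hx0]
    have := pow_le_pow_left₀ (norm_nonneg _) hD 2
    linarith
  have hEle : ∀ j, E j ≤ D ^ 2 / 2 := by
    intro j
    induction j with
    | zero => exact hE0
    | succ j ih =>
      have := step j
      have hp := (hseq (j + 1)).1
      have : 0 ≤ A (j + 1) * L / 2 * ‖yt (j + 1) - xt j‖ ^ 2 := by positivity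
      linarith
  intro j
  have h1 := step j
  have h2 := hEle j
  have h3 : 0 ≤ E (j + 1) := by
    obtain ⟨q1, q2, q3, q4⟩ := hseq (j + 1)
    have htau : 0 < tau (j + 1) := by rw [q2]; positivity
    have := hmin _ (hyd (j + 1))
    have := mul_nonneg q1 (sub_nonneg.2 this)
    have : 0 ≤ tau (j + 1) / 2 * ‖x (j + 1) - xs‖ ^ 2 := by positivity
    simp only [hE]; linarith
  linarith
/-! ### The inner problems -/

lemma sq_shift {E : Type*} [NormedAddCommGroup E] [InnerProductSpace ℝ E] (u w p : E) :
    ‖w - p‖ ^ 2 = ‖u - p‖ ^ 2 + 2 * ⟪u - p, w - u⟫ + ‖w - u‖ ^ 2 := by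
  rw [← norm_add_sq_real]; congr 2; abel

lemma aug_exact (f : Euc n → ℝ) (f' : Euc n → Euc n) (A : Euc n →L[ℝ] Euc m)
    (bvec nu : Euc m) (rho gp c1 c2 : ℝ) (x0 xk u w : Euc n) :
    (f w + gp / 2 * ‖w - x0‖ ^ 2 + ⟪nu, A w - bvec⟫ + rho / 2 * ‖A w - bvec‖ ^ 2 - c1 +
        c2 / 2 * ‖w - xk‖ ^ 2) =
      (f u + gp / 2 * ‖u - x0‖ ^ 2 + ⟪nu, A u - bvec⟫ + rho / 2 * ‖A u - bvec‖ ^ 2 - c1 +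
        c2 / 2 * ‖u - xk‖ ^ 2) +
      ⟪augGrad f' A bvec rho nu u + gp • (u - x0) + c2 • (u - xk), w - u⟫ +
      (f w - f u - ⟪f' u, w - u⟫) + (gp + c2) / 2 * ‖w - u‖ ^ 2 +
      rho / 2 * ‖A (w - u)‖ ^ 2 := by
  have e1 := sq_shift u w x0
  have e2 := sq_shift u w xk
  have e3 := sq_shift (A u) (A w) bvec
  have e4 : ⟪nu, A w - bvec⟫ = ⟪nu, A u - bvec⟫ + ⟪nu, A (w - u)⟫ := by
    rw [← inner_add_right, map_sub]; congr 1; abel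
  rw [← map_sub] at e3
  simp only [augGrad, inner_add_left, real_inner_smul_left,
    ContinuousLinearMap.adjoint_inner_left]
  rw [e1, e2, e3, e4]
  ring

lemma isProx_opt {s : Set (Euc n)} {h : Euc n → ℝ} (hh : ConvexOn ℝ s h) {ka : ℝ}
    (hka : 0 < ka) {x G p : Euc n} (hp : IsProxPt s h ka⁻¹ (x - ka⁻¹ • G) p) :
    ∀ w ∈ s, h p + ⟪ka • (x - p) - G, w - p⟫ ≤ h w := by
  refine prox_opt hh ka G x p hp.1 ?_
  intro u hu
  have h1 := hp.2 hu
  have ex : ∀ z : Euc n, ‖z - (x - ka⁻¹ • G)‖ ^ 2 =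
      ‖z - x‖ ^ 2 + 2 * (ka⁻¹ * (⟪G, z⟫ - ⟪G, x⟫)) + ka⁻¹ ^ 2 * ‖G‖ ^ 2 := by
    intro z
    have : z - (x - ka⁻¹ • G) = (z - x) + ka⁻¹ • G := by abel
    rw [this, norm_add_sq_real, real_inner_smul_right, norm_smul, mul_pow, real_inner_comm,
      inner_sub_right, Real.norm_eq_abs, sq_abs]
  rw [ex, ex] at h1
  have h2 := mul_le_mul_of_nonneg_left h1 hka.le
  have i : ka * ka⁻¹ = 1 := mul_inv_cancel₀ hka.ne'
  have r : ∀ a b c d : ℝ, ka * (ka⁻¹ * a + (b + 2 * (ka⁻¹ * c) + d) / 2) =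
      a + ka / 2 * b + c + ka * d / 2 := by
    intro a b c d
    have : ka * (ka⁻¹ * a + (b + 2 * (ka⁻¹ * c) + d) / 2) =
      (ka * ka⁻¹) * a + ka / 2 * b + (ka * ka⁻¹) * c + ka * d / 2 := by ring
    rw [this, i]; ring
  rw [r, r] at h2
  linarith

lemma inner_conv {domh : Set (Euc n)} {g h : Euc n → ℝ} {G : Euc n → Euc n}
    {L mu D c2 e : ℝ} {xk : Euc n} {x y xt yt P Gm : ℕ → Euc n} {a A tau : ℕ → ℝ}
    (hs : ACGSpec domh g h (fun u => G u + c2 • (u - xk)) L mu xk x y xt yt a A tau)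
    (hL : 0 < L) (hmu : 0 < mu) (he : 0 < e) (hD1 : 1 ≤ D)
    (hc2 : c2 = e / (4 * D ^ 2)) (hc2mu : c2 ≤ mu)
    (hh : ConvexOn ℝ domh h)
    (hlow : ∀ u w, g u + ⟪G u + c2 • (u - xk), w - u⟫ + mu / 2 * ‖w - u‖ ^ 2 ≤ g w)
    (hup : ∀ u w, g w ≤ g u + ⟪G u + c2 • (u - xk), w - u⟫ + (L + mu) / 2 * ‖w - u‖ ^ 2)
    (hex : ∃ xs ∈ domh, ∀ w ∈ domh, g xs + h xs ≤ g w + h w)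
    (hdiam : ∀ u ∈ domh, ∀ w ∈ domh, ‖u - w‖ ≤ D)
    (hP : ∀ j, IsProxPt domh h (2 * L + mu)⁻¹ (xt j - (2 * L + mu)⁻¹ • G (xt j)) (P j))
    (hGm : ∀ j, Gm j = (2 * L + mu) • (xt j - P j))
    (j : ℕ) (hj : 12 * (L + mu) * D ^ 2 / e ≤ (1 + Real.sqrt ((2 * L)⁻¹ * mu) / 2) ^ j) :
    ‖Gm j‖ ≤ e / (2 * D) := by
  obtain ⟨xs, hxs, hmin⟩ := hex
  have hxk : xk ∈ domh := hs.2.2.2.2.1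
  have hD0 : 0 < D := by linarith
  have hb := acg_bound hs hL hmu.le hh hlow hup xs hxs hmin (hdiam _ hxk _ hxs) j
  have hgr := (seq_growth (by positivity) hmu.le hs.1 hs.2.2.2.2.2.2.1
    (acg_seq hs hL hmu.le) j).1
  have hka : 0 < 2 * L + mu := by linarith
  obtain ⟨-, -, -, -, -, -, -, -, -, hytd, hytmin, -, -⟩ := hs
  have o1 := isProx_opt hh hka (hP j) (yt (j + 1)) (hytd j)
  have o2 := prox_opt hh (2 * L + mu) _ (xt j) (yt (j + 1)) (hytd j) (by
      intro u hu
      have := hytmin j u hu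
      simp only [inner_sub_right (G (xt j) + _)] at this
      show ⟪G (xt j) + c2 • (xt j - xk), _⟫ + _ + _ ≤ _
      linarith) (P j) (hP j).1
  have hc20 : 0 ≤ c2 := by rw [hc2]; positivity
  -- distance between `P j` and `yt (j+1)`
  have d1 : (2 * L + mu) * ‖yt (j + 1) - P j‖ ≤ c2 * ‖xt j - xk‖ := by
    have s1 : ⟪(2 * L + mu) • (yt (j + 1) - P j) + c2 • (xt j - xk), yt (j + 1) - P j⟫ ≤ 0 := by
      have e1 : (2 * L + mu) • (yt (j + 1) - P j) + c2 • (xt j - xk) =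
          ((2 * L + mu) • (xt j - P j) - G (xt j)) -
          ((2 * L + mu) • (xt j - yt (j + 1)) - (G (xt j) + c2 • (xt j - xk))) := by module
      rw [e1, inner_sub_left]
      rw [← neg_sub (yt (j + 1)) (P j), inner_neg_right] at o2
      linarith
    rw [inner_add_left, real_inner_smul_left, real_inner_smul_left,
      real_inner_self_eq_norm_sq] at s1
    have cs : - ⟪xt j - xk, yt (j + 1) - P j⟫ ≤ ‖xt j - xk‖ * ‖yt (j + 1) - P j‖ := by
      have := abs_real_inner_le_norm (xt j - xk) (yt (j + 1) - P j)
      have := neg_abs_le ⟪xt j - xk, yt (j + 1) - P j⟫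
      linarith
    have cs' := mul_le_mul_of_nonneg_left cs hc20
    rcases (norm_nonneg (yt (j + 1) - P j)).eq_or_lt with h0 | h0
    · rw [← h0]; simp; positivity
    · have : (2 * L + mu) * ‖yt (j + 1) - P j‖ * ‖yt (j + 1) - P j‖ ≤
          c2 * ‖xt j - xk‖ * ‖yt (j + 1) - P j‖ := by nlinarith
      exact le_of_mul_le_mul_right this h0
  have d2 : ‖xt j - xk‖ ≤ ‖yt (j + 1) - xt j‖ + D := by
    have : xt j - xk = (xt j - yt (j + 1)) + (yt (j + 1) - xk) := by abel
    rw [this, norm_sub_rev (yt (j + 1)) (xt j)]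
    exact (norm_add_le _ _).trans (add_le_add_right (hdiam _ (hytd j) _ hxk) _)
  have d3 : ‖xt j - P j‖ ≤ ‖yt (j + 1) - xt j‖ + ‖yt (j + 1) - P j‖ := by
    have : xt j - P j = (xt j - yt (j + 1)) + (yt (j + 1) - P j) := by abel
    rw [this, norm_sub_rev (yt (j + 1)) (xt j)]
    exact norm_add_le _ _
  have hu0 := norm_nonneg (yt (j + 1) - xt j)
  set U := ‖yt (j + 1) - xt j‖
  -- bound on `U`
  have hU : (L + mu) * U ≤ e / (8 * D) := by
    set T := 12 * (L + mu) * D ^ 2 / e with hT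
    have hT0 : 0 < T := by positivity
    set Q := (1 + Real.sqrt ((2 * L)⁻¹ * mu) / 2) ^ j
    have hQ : T ^ 2 ≤ Q ^ 2 := pow_le_pow_left₀ hT0.le hj 2
    have h1 : T ^ 2 * U ^ 2 ≤ 2 * D ^ 2 := by
      have : L * ((2 * L)⁻¹ * Q ^ 2) * U ^ 2 ≤ D ^ 2 :=
        (mul_le_mul_of_nonneg_right (mul_le_mul_of_nonneg_left hgr hL.le)
          (sq_nonneg _)).trans hb
      have e1 : L * ((2 * L)⁻¹ * Q ^ 2) = Q ^ 2 / 2 := by field_simp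
      rw [e1] at this
      nlinarith [mul_le_mul_of_nonneg_right hQ (sq_nonneg U)]
    have h2 : T * U ≤ 3 / 2 * D := by
      refine le_of_sq_le_sq ?_ (by positivity)
      nlinarith [sq_nonneg D]
    have h3 : T * U = (L + mu) * U * (12 * D ^ 2 / e) := by rw [hT]; ring
    rw [h3] at h2
    have h4 : (L + mu) * U ≤ 3 / 2 * D / (12 * D ^ 2 / e) := by
      rw [le_div_iff₀ (by positivity)]; exact h2
    have h5 : 3 / 2 * D / (12 * D ^ 2 / e) = e / (8 * D) := by field_simp; norm_num
    rwa [h5] at h4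
  have hcD : c2 * D = e / (4 * D) := by rw [hc2]; field_simp
  rw [hGm, norm_smul, Real.norm_of_nonneg hka.le]
  have f1 := mul_le_mul_of_nonneg_left d3 hka.le
  have f2 := mul_le_mul_of_nonneg_left d2 hc20
  have f3 := mul_le_mul_of_nonneg_right hc2mu hu0
  have e1 : e / (2 * D) = e / (4 * D) + 2 * (e / (8 * D)) := by field_simp; norm_num
  nlinarith

lemma pow_large {s t : ℝ} (hs : 0 < s) (j : ℕ) (hj : t * (1 + 1 / s) ≤ j) (ht : 0 ≤ t) :
    Real.exp t ≤ (1 + s) ^ j := by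
  have h1 : 0 < 1 + s := by linarith
  rw [← Real.exp_log h1, ← Real.exp_nat_mul, Real.exp_le_exp]
  have h2 := Real.one_sub_inv_le_log_of_pos h1
  have h3 : 1 - (1 + s)⁻¹ = s / (1 + s) := by field_simp; ring
  rw [h3] at h2
  have h4 : t = t * (1 + 1 / s) * (s / (1 + s)) := by field_simp; ring
  calc t = t * (1 + 1 / s) * (s / (1 + s)) := h4
    _ ≤ j * (s / (1 + s)) := mul_le_mul_of_nonneg_right hj (by positivity)
    _ ≤ _ := mul_le_mul_of_nonneg_left h2 (by positivity)

/-- first-order information at the output of an inner call -/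
lemma primal_facts {domh : Set (Euc n)} {f h : Euc n → ℝ} {f' : Euc n → Euc n}
    {A : Euc n →L[ℝ] Euc m} {bvec nu lam : Euc m} {Lf L rho gp mu : ℝ} {x0 xt P Gm : Euc n}
    (hfc : ConvexOn ℝ Set.univ f) (hf : HasLipGrad f f' Lf) (hLf : 0 < Lf)
    (hh : ConvexOn ℝ domh h) (hrho : 0 ≤ rho) (hgp : 0 ≤ gp) (hmu : gp ≤ mu)
    (hL : L = Lf + rho * ‖A‖ ^ 2)
    (hP : IsProxPt domh h (2 * L + mu)⁻¹
      (xt - (2 * L + mu)⁻¹ • (augGrad f' A bvec rho nu xt + gp • (xt - x0))) P)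
    (hGm : Gm = (2 * L + mu) • (xt - P))
    (hlam : lam = nu + rho • (A P - bvec)) :
    ∃ v : Euc n, ‖v‖ ≤ 2 * ‖Gm‖ ∧ ∀ w ∈ domh,
      f P + h P + ⟪lam, A P - bvec⟫ + ⟪v - gp • (P - x0), w - P⟫ ≤
        f w + h w + ⟪lam, A w - bvec⟫ := by
  have hA0 : 0 ≤ rho * ‖A‖ ^ 2 := by positivity
  have hL0 : 0 < L := by rw [hL]; linarith
  have hka : 0 < 2 * L + mu := by linarith
  have o := isProx_opt hh hka hP
  refine ⟨Gm + (f' P - f' xt) + rho • (ContinuousLinearMap.adjoint A) (A (P - xt)) +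
    gp • (P - xt), ?_, ?_⟩
  · have h1 := hf.2 P xt
    have h2 : ‖rho • (ContinuousLinearMap.adjoint A) (A (P - xt))‖ ≤
        rho * ‖A‖ ^ 2 * ‖P - xt‖ := by
      rw [norm_smul, Real.norm_of_nonneg hrho]
      have a1 := (ContinuousLinearMap.adjoint A).le_opNorm (A (P - xt))
      have a2 := A.le_opNorm (P - xt)
      rw [LinearIsometryEquiv.norm_map] at a1
      have a3 := mul_le_mul_of_nonneg_left a2 (norm_nonneg A)
      have := mul_le_mul_of_nonneg_left (a1.trans a3) hrho
      nlinarith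
    have h3 : ‖gp • (P - xt)‖ = gp * ‖P - xt‖ := by
      rw [norm_smul, Real.norm_of_nonneg hgp]
    have h4 : ‖Gm‖ = (2 * L + mu) * ‖P - xt‖ := by
      rw [hGm, norm_smul, Real.norm_of_nonneg hka.le, norm_sub_rev]
    have t1 := norm_add_le (Gm + (f' P - f' xt) +
      rho • (ContinuousLinearMap.adjoint A) (A (P - xt))) (gp • (P - xt))
    have t2 := norm_add_le (Gm + (f' P - f' xt))
      (rho • (ContinuousLinearMap.adjoint A) (A (P - xt)))
    have t3 := norm_add_le Gm (f' P - f' xt)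
    have h5 : (L + gp) * ‖P - xt‖ ≤ (2 * L + mu) * ‖P - xt‖ :=
      mul_le_mul_of_nonneg_right (by linarith) (norm_nonneg _)
    rw [hL] at h5 h4
    nlinarith
  · intro w hw
    have h1 := o w hw
    have h2 := convex_lower hf.1 hfc P w
    have e1 : ⟪lam, A w - bvec⟫ = ⟪lam, A P - bvec⟫ +
        ⟪(ContinuousLinearMap.adjoint A) lam, w - P⟫ := by
      rw [ContinuousLinearMap.adjoint_inner_left, ← inner_add_right, map_sub]; congr 1; abel
    have e2 : Gm + (f' P - f' xt) + rho • (ContinuousLinearMap.adjoint A) (A (P - xt)) +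
        gp • (P - xt) - gp • (P - x0) =
        ((2 * L + mu) • (xt - P) - (augGrad f' A bvec rho nu xt + gp • (xt - x0))) + f' P +
          (ContinuousLinearMap.adjoint A) lam := by
      rw [hGm, hlam, augGrad]
      simp only [map_sub, map_add, map_smul]
      module
    rw [e2, e1, inner_add_left, inner_add_left]
    linarith
/-! ### One outer step -/

set_option maxHeartbeats 1000000 in
lemma outer_step {E : Type*} [NormedAddCommGroup E] [InnerProductSpace ℝ E]
    (lam nu nut lamp nup r z : E) (B b B' tau tau' ga rho e : ℝ) (dp : E → ℝ)
    (hB : 0 ≤ B) (hb : 0 < b) (hga : 0 < ga) (hrho : 0 < rho) (hsmall : rho * ga ≤ 1 / 45)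
    (hB' : B' = B + b) (htau : tau = 1 + ga * B) (htau' : tau' = 1 + ga * B')
    (hq : b ^ 2 = rho * tau * B')
    (hnut : B' • nut = B • lam + b • nu) (hlamp : lamp = nut + rho • r)
    (hnup : tau' • nup = tau • nu + b • r)
    (hsup : ∀ x, dp x ≤ dp lamp + e + ⟪r, x - lamp⟫) :
    B' * ((dp z - ga / 2 * ‖z‖ ^ 2) - (dp lamp - ga / 2 * ‖lamp‖ ^ 2)) +
        tau' / 2 * ‖nup - z‖ ^ 2 ≤
      B * ((dp z - ga / 2 * ‖z‖ ^ 2) - (dp lam - ga / 2 * ‖lam‖ ^ 2)) +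
        tau / 2 * ‖nu - z‖ ^ 2 +
        B' * (e + 4 * rho * ga ^ 2 * ‖nu‖ ^ 2 - 2 / 5 * rho * ‖r‖ ^ 2) := by
  have hB'0 : 0 < B' := by linarith
  have htau0 : 0 < tau := by rw [htau]; positivity
  have htau'0 : 0 < tau' := by rw [htau']; positivity
  obtain ⟨w, hw⟩ : ∃ w : E, B' • w = B • lam + b • nup :=
    ⟨B'⁻¹ • (B • lam + b • nup), by rw [smul_smul, mul_inv_cancel₀ hB'0.ne', one_smul]⟩
  set d := w - lamp with hd
  -- (1) supergradient
  have g1 := mul_le_mul_of_nonneg_left (hsup lam) hB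
  have g2 := mul_le_mul_of_nonneg_left (hsup z) hb.le
  -- (2) quadratic minimisation
  have q1 : b * ⟪r, z⟫ = tau' * ⟪nup, z⟫ - tau * ⟪nu, z⟫ := by
    have := congrArg (fun v => ⟪v, z⟫) hnup
    simp only [inner_add_left, real_inner_smul_left] at this
    linarith
  have q2 : b * ⟪r, nup⟫ = tau' * ‖nup‖ ^ 2 - tau * ⟪nu, nup⟫ := by
    have := congrArg (fun v => ⟪v, nup⟫) hnup
    simp only [inner_add_left, real_inner_smul_left, real_inner_self_eq_norm_sq] at this
    linarith
  have tt : tau' = tau + b * ga := by rw [htau', htau, hB']; ring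
  have q3 : b * ⟪r, z⟫ - b * ga / 2 * ‖z‖ ^ 2 - tau / 2 * ‖nu - z‖ ^ 2 +
      tau' / 2 * ‖nup - z‖ ^ 2 =
      b * ⟪r, nup⟫ - b * ga / 2 * ‖nup‖ ^ 2 - tau / 2 * ‖nup - nu‖ ^ 2 := by
    rw [q1, q2, norm_sub_sq_real, norm_sub_sq_real, norm_sub_sq_real, real_inner_comm nu nup, tt]
    ring
  -- (3) facts on w
  have w1 : B' * ‖w - nut‖ ^ 2 = rho * tau * ‖nup - nu‖ ^ 2 := by
    have h1 : B' • (w - nut) = b • (nup - nu) := by rw [smul_sub, hw, hnut]; module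
    have h2 : B' ^ 2 * ‖w - nut‖ ^ 2 = b ^ 2 * ‖nup - nu‖ ^ 2 := by
      have := congrArg (fun v => ‖v‖ ^ 2) h1
      simpa only [norm_smul, mul_pow, Real.norm_eq_abs, sq_abs] using this
    rw [hq] at h2
    have h3 : B' * (B' * ‖w - nut‖ ^ 2) = B' * (rho * tau * ‖nup - nu‖ ^ 2) := by linarith
    exact mul_left_cancel₀ hB'0.ne' h3
  have w2 : ‖w - nut‖ ^ 2 = rho ^ 2 * ‖r‖ ^ 2 + 2 * (rho * ⟪r, d⟫) + ‖d‖ ^ 2 := by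
    have : w - nut = rho • r + d := by rw [hd, hlamp]; abel
    rw [this, norm_add_sq_real, norm_smul, mul_pow, real_inner_smul_left, Real.norm_eq_abs, sq_abs]
  have w3 : B * ⟪r, lam⟫ + b * ⟪r, nup⟫ = B' * ⟪r, d⟫ + B' * ⟪r, lamp⟫ := by
    have := congrArg (fun v => ⟪r, v⟫) hw
    simp only [inner_add_right, real_inner_smul_right] at this
    have e1 : ⟪r, w⟫ = ⟪r, d⟫ + ⟪r, lamp⟫ := by rw [← inner_add_right, hd]; congr 1; abel
    rw [e1] at this
    linarith
  have w4 : B' * (B * ‖lam‖ ^ 2 + b * ‖nup‖ ^ 2) =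
      B' * (B' * ‖w‖ ^ 2) + B * b * ‖lam - nup‖ ^ 2 := by
    have := congrArg (fun v => ‖v‖ ^ 2) hw
    simp only [norm_add_sq_real, norm_smul, mul_pow, Real.norm_eq_abs, sq_abs,
      real_inner_smul_left, real_inner_smul_right] at this
    rw [norm_sub_sq_real, ← mul_assoc B' B', ← pow_two, this, hB']
    ring
  have w5 : ‖lamp‖ ^ 2 = ‖w‖ ^ 2 - 2 * ⟪w, d⟫ + ‖d‖ ^ 2 := by
    rw [← norm_sub_sq_real]; congr 2; rw [hd]; abel
  have two : ∀ p q : E, ‖p + q‖ ^ 2 ≤ 2 * ‖p‖ ^ 2 + 2 * ‖q‖ ^ 2 := by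
    intro p q
    have h1 := norm_add_sq_real p q
    have h2 := norm_sub_sq_real p q
    nlinarith [sq_nonneg ‖p - q‖]
  have w6 : B' ^ 2 * ‖w‖ ^ 2 ≤ 2 * B' ^ 2 * ‖nup‖ ^ 2 + 2 * B ^ 2 * ‖lam - nup‖ ^ 2 := by
    have h1 : B' • w = B' • nup + B • (lam - nup) := by rw [hw, hB']; module
    have h2 := congrArg (fun v => ‖v‖ ^ 2) h1
    have h3 := two (B' • nup) (B • (lam - nup))
    simp only [norm_smul, mul_pow, Real.norm_eq_abs, sq_abs] at h2 h3
    linarith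
  have w7 : ga ^ 2 * ‖nup‖ ^ 2 ≤ 2 * ga ^ 2 * ‖nu‖ ^ 2 + 2 / 45 * ‖r‖ ^ 2 := by
    have h2 := congrArg (fun v => ‖v‖ ^ 2) hnup
    have h3 := two (tau • nu) (b • r)
    simp only [norm_smul, mul_pow, Real.norm_eq_abs, sq_abs] at h2 h3
    have hlt : tau ≤ tau' := by
      have : 0 < b * ga := by positivity
      linarith
    have h4 : tau ^ 2 * ‖nu‖ ^ 2 ≤ tau' ^ 2 * ‖nu‖ ^ 2 := by gcongr
    have h5 : ga ^ 2 * b ^ 2 ≤ 1 / 45 * tau' ^ 2 := by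
      have a1 : ga * B' ≤ tau' := by rw [htau']; linarith
      calc ga ^ 2 * b ^ 2 = (rho * ga) * (tau * (ga * B')) := by rw [hq]; ring
        _ ≤ (1 / 45) * (tau' * tau') := by gcongr
        _ = _ := by ring
    have h6 : tau' ^ 2 * (ga ^ 2 * ‖nup‖ ^ 2) ≤
        tau' ^ 2 * (2 * ga ^ 2 * ‖nu‖ ^ 2 + 2 / 45 * ‖r‖ ^ 2) := by
      have a1 := mul_le_mul_of_nonneg_right h5 (sq_nonneg ‖r‖)
      have a2 := mul_le_mul_of_nonneg_left h4 (sq_nonneg ga)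
      have a3 : ga ^ 2 * (tau' ^ 2 * ‖nup‖ ^ 2) ≤
          ga ^ 2 * (2 * (tau ^ 2 * ‖nu‖ ^ 2) + 2 * (b ^ 2 * ‖r‖ ^ 2)) :=
        mul_le_mul_of_nonneg_left (h2.le.trans h3) (sq_nonneg ga)
      linarith
    exact le_of_mul_le_mul_left h6 (by positivity)
  -- b is large
  have hbl : 4 * (rho * ga) * B ≤ b := by
    refine le_of_sq_le_sq ?_ hb.le
    have a1 : rho * ga * B ^ 2 ≤ b ^ 2 := by
      rw [hq, htau, hB']
      have : 0 ≤ rho * B + rho * b + rho * ga * B * b := by positivity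
      nlinarith
    have a2 : (rho * ga) * (rho * ga) ≤ (rho * ga) * (1 / 45) :=
      mul_le_mul_of_nonneg_left hsmall (by positivity)
    have a3 := mul_le_mul_of_nonneg_right a2 (sq_nonneg B)
    have : 0 ≤ rho * ga * B ^ 2 := by positivity
    nlinarith
  -- Young
  have yg : -(ga * ⟪w, d⟫) + ga / 2 * ‖d‖ ^ 2 - ‖d‖ ^ 2 / (2 * rho) ≤
      rho * ga ^ 2 * ‖w‖ ^ 2 := by
    have cs : -⟪w, d⟫ ≤ ‖w‖ * ‖d‖ := by
      have := abs_real_inner_le_norm w d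
      have := neg_abs_le ⟪w, d⟫
      linarith
    have cs' := mul_le_mul_of_nonneg_left cs hga.le
    have a1 : rho * (-(ga * ⟪w, d⟫) + ga / 2 * ‖d‖ ^ 2 - ‖d‖ ^ 2 / (2 * rho)) =
        rho * (-(ga * ⟪w, d⟫)) + rho * ga / 2 * ‖d‖ ^ 2 - ‖d‖ ^ 2 / 2 := by
      field_simp
    have a2 : rho * (-(ga * ⟪w, d⟫)) ≤ rho * (ga * (‖w‖ * ‖d‖)) :=
      mul_le_mul_of_nonneg_left (by linarith) hrho.le
    have a3 := mul_le_mul_of_nonneg_right hsmall (sq_nonneg ‖d‖)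
    have a4 := sq_nonneg (rho * ga * ‖w‖ - ‖d‖ / 2)
    have a5 := sq_nonneg ‖d‖
    have : rho * (-(ga * ⟪w, d⟫) + ga / 2 * ‖d‖ ^ 2 - ‖d‖ ^ 2 / (2 * rho)) ≤
        rho * (rho * ga ^ 2 * ‖w‖ ^ 2) := by
      rw [a1]; linarith
    exact le_of_mul_le_mul_left this hrho
  -- assemble: T bound
  have w2' : tau / 2 * ‖nup - nu‖ ^ 2 =
      B' * (rho / 2 * ‖r‖ ^ 2 + ⟪r, d⟫ + ‖d‖ ^ 2 / (2 * rho)) := by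
    have : rho * (tau / 2 * ‖nup - nu‖ ^ 2) =
        rho * (B' * (rho / 2 * ‖r‖ ^ 2 + ⟪r, d⟫ + ‖d‖ ^ 2 / (2 * rho))) := by
      have e1 : rho * (tau / 2 * ‖nup - nu‖ ^ 2) = (rho * tau * ‖nup - nu‖ ^ 2) / 2 := by ring
      rw [e1, ← w1, w2]; field_simp
    exact mul_left_cancel₀ hrho.ne' this
  set X := ‖lam - nup‖ ^ 2
  have hX : 0 ≤ X := sq_nonneg _
  have w4' : B * ‖lam‖ ^ 2 + b * ‖nup‖ ^ 2 = B' * ‖w‖ ^ 2 + B * b * X / B' := by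
    field_simp; linarith
  have w6' : B' * ‖w‖ ^ 2 ≤ 2 * B' * ‖nup‖ ^ 2 + 2 * B ^ 2 * X / B' := by
    have : 2 * B' * ‖nup‖ ^ 2 + 2 * B ^ 2 * X / B' =
      (2 * B' ^ 2 * ‖nup‖ ^ 2 + 2 * B ^ 2 * X) / B' := by field_simp
    rw [this, le_div_iff₀ hB'0]; linarith
  have xk : rho * ga ^ 2 * (2 * B ^ 2 * X / B') ≤ ga / 2 * (B * b * X / B') := by
    have a1 : rho * ga ^ 2 * (2 * B ^ 2 * X / B') =
        (ga / 2 * (B * X / B')) * (4 * (rho * ga) * B) := by ring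
    have a2 : ga / 2 * (B * b * X / B') = (ga / 2 * (B * X / B')) * b := by ring
    rw [a1, a2]
    exact mul_le_mul_of_nonneg_left hbl (by positivity)
  have yg' := mul_le_mul_of_nonneg_left yg hB'0.le
  have w6'' := mul_le_mul_of_nonneg_left w6' (show 0 ≤ rho * ga ^ 2 by positivity)
  have w7' := mul_le_mul_of_nonneg_left w7 (show 0 ≤ 2 * rho * B' by positivity)
  have hr : 0 ≤ B' * rho * ‖r‖ ^ 2 := by positivity
  rw [inner_sub_right] at g1 g2
  have key : B' * ⟪r, d⟫ + ga / 2 * (B' * ‖lamp‖ ^ 2 - (B * ‖lam‖ ^ 2 + b * ‖nup‖ ^ 2))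
      - tau / 2 * ‖nup - nu‖ ^ 2 ≤
      B' * (4 * rho * ga ^ 2 * ‖nu‖ ^ 2 - 2 / 5 * rho * ‖r‖ ^ 2) := by
    rw [w4', w5, w2']
    linarith
  have fin : B * dp lam + b * dp z ≤ B' * (dp lamp + e) + (B * ⟪r, lam⟫ + b * ⟪r, z⟫)
      - B' * ⟪r, lamp⟫ := by
    rw [hB']; linarith
  have e0 : B' * (dp z - ga / 2 * ‖z‖ ^ 2) = B * (dp z - ga / 2 * ‖z‖ ^ 2) +
      b * (dp z - ga / 2 * ‖z‖ ^ 2) := by rw [hB']; ring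
  linarith
/-! ### Number of inner iterations -/

lemma inner_J {domh : Set (Euc n)} {f h : Euc n → ℝ} {f' : Euc n → Euc n}
    {A : Euc n →L[ℝ] Euc m} {bvec nu : Euc m} {Lf L rho gp mu D e c1 : ℝ} {x0 xk : Euc n}
    {x y xt yt P Gm : ℕ → Euc n} {a Ai tau : ℕ → ℝ} {J : ℕ}
    (hfc : ConvexOn ℝ Set.univ f) (hf : HasLipGrad f f' Lf) (hLf : 0 < Lf)
    (hh : ConvexOn ℝ domh h) (hcl : IsClosed domh) (hlsc : LowerSemicontinuousOn h domh)
    (hne : domh.Nonempty) (hD1 : 1 ≤ D) (hdiam : ∀ u ∈ domh, ∀ w ∈ domh, ‖u - w‖ ≤ D)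
    (hrho : 0 ≤ rho) (hgp : 0 < gp) (he : 0 < e) (hmu : mu = gp + e / (4 * D ^ 2))
    (hL : L = Lf + rho * ‖A‖ ^ 2)
    (hs : ACGSpec domh
      (fun u => f u + gp / 2 * ‖u - x0‖ ^ 2 + ⟪nu, A u - bvec⟫ +
        rho / 2 * ‖A u - bvec‖ ^ 2 - c1 + e / (8 * D ^ 2) * ‖u - xk‖ ^ 2)
      h
      (fun u => augGrad f' A bvec rho nu u + gp • (u - x0) + (e / (4 * D ^ 2)) • (u - xk))
      L mu xk x y xt yt a Ai tau)
    (hP : ∀ j, IsProxPt domh h (2 * L + mu)⁻¹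
      (xt j - (2 * L + mu)⁻¹ • (augGrad f' A bvec rho nu (xt j) + gp • (xt j - x0))) (P j))
    (hGm : ∀ j, Gm j = (2 * L + mu) • (xt j - P j))
    (hJ : ∀ j, j < J → ¬ (‖Gm j‖ ≤ e / (2 * D)))
    {t s : ℝ} (ht : 0 ≤ t) (hT : 12 * (L + mu) * D ^ 2 / e ≤ Real.exp t)
    (hs0 : 0 < s) (hsle : s ≤ Real.sqrt ((2 * L)⁻¹ * mu) / 2) :
    (J : ℝ) ≤ t * (1 + 1 / s) + 1 := by
  have hD0 : 0 < D := by linarith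
  have hA0 : 0 ≤ rho * ‖A‖ ^ 2 := by positivity
  have hL0 : 0 < L := by rw [hL]; linarith
  have hc0 : 0 < e / (4 * D ^ 2) := by positivity
  have hmu0 : 0 < mu := by rw [hmu]; linarith
  have hc : e / (8 * D ^ 2) = (e / (4 * D ^ 2)) / 2 := by field_simp; norm_num
  have hfd : Continuous f := by
    rw [continuous_iff_continuousAt]; intro z; exact (hf.1 z).differentiableAt.continuousAt
  have hAle : ∀ u w : Euc n, rho / 2 * ‖A (w - u)‖ ^ 2 ≤ rho * ‖A‖ ^ 2 / 2 * ‖w - u‖ ^ 2 := by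
    intro u w
    have a1 := pow_le_pow_left₀ (norm_nonneg _) (A.le_opNorm (w - u)) 2
    have a2 := mul_le_mul_of_nonneg_left a1 (show 0 ≤ rho / 2 by linarith)
    calc _ ≤ _ := a2
      _ = _ := by ring
  have hjN := Nat.le_ceil (t * (1 + 1 / s))
  have hlt := Nat.ceil_lt_add_one (show 0 ≤ t * (1 + 1 / s) by positivity)
  set j := ⌈t * (1 + 1 / s)⌉₊
  have hpow := pow_large hs0 j hjN ht
  have hpow2 : (1 + s) ^ j ≤ (1 + Real.sqrt ((2 * L)⁻¹ * mu) / 2) ^ j :=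
    pow_le_pow_left₀ (by linarith) (by linarith) j
  have hcomp : IsCompact domh := by
    refine Metric.isCompact_of_isClosed_isBounded hcl ?_
    rw [Metric.isBounded_iff]
    exact ⟨D, fun u hu w hw => by rw [dist_eq_norm]; exact hdiam u hu w hw⟩
  have hmain := inner_conv (G := fun u => augGrad f' A bvec rho nu u + gp • (u - x0))
    (e := e) (D := D) hs hL0 hmu0 he hD1 rfl (by linarith) hh ?_ ?_ ?_ hdiam hP hGm j
    (hT.trans (hpow.trans hpow2))
  · have : ¬ (j < J) := fun hlt => hJ j hlt hmain
    have : (J : ℝ) ≤ (j : ℝ) := by exact_mod_cast not_lt.mp this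
    linarith
  · intro u w
    have e1 := aug_exact f f' A bvec nu rho gp c1 (e / (4 * D ^ 2)) x0 xk u w
    have e2 := convex_lower hf.1 hfc u w
    have e3 : 0 ≤ rho / 2 * ‖A (w - u)‖ ^ 2 := by positivity
    simp only [hc]
    rw [e1, hmu]
    linarith
  · intro u w
    have e1 := aug_exact f f' A bvec nu rho gp c1 (e / (4 * D ^ 2)) x0 xk u w
    have e2 := descent hf u w
    have e3 := hAle u w
    simp only [hc]
    rw [e1, hmu, hL]
    linarith
  · have hl : LowerSemicontinuousOn (fun u => (f u + gp / 2 * ‖u - x0‖ ^ 2 + ⟪nu, A u - bvec⟫ +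
        rho / 2 * ‖A u - bvec‖ ^ 2 - c1 + e / (8 * D ^ 2) * ‖u - xk‖ ^ 2) + h u) domh := by
      refine LowerSemicontinuousOn.add ((Continuous.lowerSemicontinuous ?_).lowerSemicontinuousOn _) hlsc
      fun_prop
    obtain ⟨xs, hxs, hm⟩ := hl.exists_isMinOn hne hcomp
    exact ⟨xs, hxs, fun w hw => hm hw⟩
/-! ### Outer iterations -/

lemma dual_sup {domh : Set (Euc n)} {f h : Euc n → ℝ}
    {A : Euc n →L[ℝ] Euc m} {bvec lam : Euc m} {gp D e : ℝ} {x0 P v : Euc n} {dp : Euc m → ℝ}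
    (hgp : 0 ≤ gp) (hD : 0 < D) (he : 0 ≤ e)
    (hdp : ∀ lam : Euc m, IsLeast
      ((fun x => f x + h x + ⟪lam, A x - bvec⟫ + gp / 2 * ‖x - x0‖ ^ 2) '' domh) (dp lam))
    (hP : P ∈ domh) (hdiam : ∀ u ∈ domh, ∀ w ∈ domh, ‖u - w‖ ≤ D)
    (hv : ‖v‖ ≤ e / D)
    (hsub : ∀ w ∈ domh, f P + h P + ⟪lam, A P - bvec⟫ + ⟪v - gp • (P - x0), w - P⟫ ≤
        f w + h w + ⟪lam, A w - bvec⟫) (x : Euc m) :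
    dp x ≤ dp lam + e + ⟪A P - bvec, x - lam⟫ := by
  obtain ⟨w, hw, hwe⟩ := (hdp lam).1
  have h1 := (hdp x).2 ⟨P, hP, rfl⟩
  have h2 := hsub w hw
  have h3 := sq_shift P w x0
  simp only at hwe h1
  have h4 : -e ≤ ⟪v, w - P⟫ := by
    have a1 := abs_real_inner_le_norm v (w - P)
    have a2 := neg_abs_le ⟪v, w - P⟫
    have a3 : ‖v‖ * ‖w - P‖ ≤ e / D * D :=
      mul_le_mul hv (hdiam _ hw _ hP) (norm_nonneg _) (by positivity)
    have a4 : e / D * D = e := by field_simp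
    linarith
  have h5 : ⟪x, A P - bvec⟫ = ⟪lam, A P - bvec⟫ + ⟪A P - bvec, x - lam⟫ := by
    rw [real_inner_comm (x - lam), inner_sub_left]; ring
  rw [inner_sub_left, real_inner_smul_left] at h2
  have h6 : gp / 2 * ‖w - x0‖ ^ 2 = gp / 2 * ‖P - x0‖ ^ 2 + gp * ⟪P - x0, w - P⟫ +
    gp / 2 * ‖w - P‖ ^ 2 := by rw [h3]; ring
  have h7 : 0 ≤ gp / 2 * ‖w - P‖ ^ 2 := by positivity
  linarith

lemma outer_terminate {E : Type*} [NormedAddCommGroup E] [InnerProductSpace ℝ E]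
    {lam nu nut r : ℕ → E} {z : E} {B b tau : ℕ → ℝ} {ga rho eps alpha eps0 D R : ℝ} {dp : E → ℝ}
    (hga : 0 < ga) (hrho : 0 < rho) (heps : 0 < eps) (hrhoeps : rho * eps ≤ 1)
    (hD1 : 1 ≤ D) (halpha : 0 ≤ alpha) (heps0 : 0 < eps0) (hR1 : 1 ≤ R)
    (hgaR : ga * R ≤ eps / 45)
    (hB0 : B 0 = 0) (hnu0 : nu 0 = 0)
    (hBs : ∀ k, B (k + 1) = B k + b k)
    (hseq : ∀ k, 0 ≤ B k ∧ tau k = 1 + ga * B k ∧ 0 < b k ∧ b k ^ 2 = rho * tau k * B (k + 1))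
    (hnut : ∀ k, B (k + 1) • nut k = B k • lam k + b k • nu k)
    (hlamp : ∀ k, lam (k + 1) = nut k + rho • r k)
    (hnup : ∀ k, tau (k + 1) • nu (k + 1) = tau k • nu k + b k • r k)
    (hsup : ∀ k x, dp x ≤ dp (lam (k + 1)) + epsFALM eps0 alpha (1 / 4) rho eps k +
      ⟪r k, x - lam (k + 1)⟫)
    (hmax : ∀ x, dp x - ga / 2 * ‖x‖ ^ 2 ≤ dp z - ga / 2 * ‖z‖ ^ 2)
    (hR : ∀ k, ‖z‖ ^ 2 + 2 * (eps0 * ∑ i ∈ Finset.range k, B (i + 1) * alpha ^ i) ≤ R ^ 2)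
    (N : ℕ) (hN1 : epsFALM eps0 alpha (1 / 4) rho eps N ≤ D * eps / 2)
    (hN2 : R ^ 2 / 2 < B (N + 1) * (rho * eps ^ 2 / 3)) :
    ∃ K ≤ N, epsFALM eps0 alpha (1 / 4) rho eps K ≤ D * eps / 2 ∧ ‖r K‖ ≤ eps := by
  by_contra hcon
  push Not at hcon
  have hsmall : rho * ga ≤ 1 / 45 := by
    have a1 : ga ≤ ga * R := le_mul_of_one_le_right hga.le hR1
    have a2 := mul_le_mul_of_nonneg_left (a1.trans hgaR) hrho.le
    linarith
  obtain ⟨En, hEn⟩ : ∃ En : ℕ → ℝ, ∀ k, En k = B k * ((dp z - ga / 2 * ‖z‖ ^ 2) -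
    (dp (lam k) - ga / 2 * ‖lam k‖ ^ 2)) + tau k / 2 * ‖nu k - z‖ ^ 2 := ⟨_, fun _ => rfl⟩
  have hEpos : ∀ k, 1 / 2 * ‖nu k - z‖ ^ 2 ≤ En k := by
    intro k
    obtain ⟨h1, h2, -, -⟩ := hseq k
    rw [hEn]
    have a1 : 0 ≤ B k * ((dp z - ga / 2 * ‖z‖ ^ 2) - (dp (lam k) - ga / 2 * ‖lam k‖ ^ 2)) :=
      mul_nonneg h1 (sub_nonneg.mpr (hmax _))
    have a2 : 1 ≤ tau k := by rw [h2]; linarith [mul_nonneg hga.le h1]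
    have a3 : 1 / 2 * ‖nu k - z‖ ^ 2 ≤ tau k / 2 * ‖nu k - z‖ ^ 2 :=
      mul_le_mul_of_nonneg_right (by linarith) (sq_nonneg _)
    linarith
  have hrep : 0 < rho * eps ^ 2 := by positivity
  have hBpos : ∀ k, 0 ≤ B k := fun k => (hseq k).1
  have hzR : ‖z‖ ≤ R := by
    refine le_of_sq_le_sq ?_ (by linarith)
    simpa using hR 0
  have hgaR2 : ga ^ 2 * R ^ 2 ≤ eps ^ 2 / 2025 := by
    have := pow_le_pow_left₀ (by positivity) hgaR 2
    calc _ = (ga * R) ^ 2 := by ring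
      _ ≤ _ := this
      _ = _ := by ring
  have hstep : ∀ k, En k ≤ R ^ 2 / 2 → En (k + 1) ≤ En k +
      B (k + 1) * (epsFALM eps0 alpha (1 / 4) rho eps k + rho * eps ^ 2 * (16 / 2025) -
        2 / 5 * rho * ‖r k‖ ^ 2) := by
    intro k hk
    obtain ⟨h1, h2, h3, h4⟩ := hseq k
    have hnu : ‖nu k‖ ≤ 2 * R := by
      have a1 : ‖nu k - z‖ ≤ R := by
        refine le_of_sq_le_sq ?_ (by linarith)
        linarith [hEpos k]
      calc ‖nu k‖ = ‖(nu k - z) + z‖ := by rw [sub_add_cancel]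
        _ ≤ ‖nu k - z‖ + ‖z‖ := norm_add_le _ _
        _ ≤ 2 * R := by linarith
    have hs := outer_step (lam k) (nu k) (nut k) (lam (k + 1)) (nu (k + 1)) (r k) z (B k) (b k)
      (B (k + 1)) (tau k) (tau (k + 1)) ga rho (epsFALM eps0 alpha (1 / 4) rho eps k) dp h1 h3 hga
      hrho hsmall (hBs k) h2 (hseq (k + 1)).2.1 h4 (hnut k) (hlamp k) (hnup k) (hsup k)
    rw [← hEn, ← hEn] at hs
    refine hs.trans (add_le_add le_rfl (mul_le_mul_of_nonneg_left ?_ (hBpos _)))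
    have a1 : ‖nu k‖ ^ 2 ≤ 4 * R ^ 2 := by
      calc _ ≤ (2 * R) ^ 2 := pow_le_pow_left₀ (norm_nonneg _) hnu 2
        _ = _ := by ring
    have a2 : 4 * rho * ga ^ 2 * ‖nu k‖ ^ 2 ≤ rho * eps ^ 2 * (16 / 2025) := by
      calc 4 * rho * ga ^ 2 * ‖nu k‖ ^ 2 ≤ 4 * rho * ga ^ 2 * (4 * R ^ 2) :=
            mul_le_mul_of_nonneg_left a1 (by positivity)
        _ = 16 * rho * (ga ^ 2 * R ^ 2) := by ring
        _ ≤ 16 * rho * (eps ^ 2 / 2025) := mul_le_mul_of_nonneg_left hgaR2 (by positivity)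
        _ = _ := by ring
    linarith
  have hr2 : ∀ k ≤ N, epsFALM eps0 alpha (1 / 4) rho eps k ≤ D * eps / 2 →
      epsFALM eps0 alpha (1 / 4) rho eps k + rho * eps ^ 2 * (16 / 2025) -
        2 / 5 * rho * ‖r k‖ ^ 2 ≤ eps0 * alpha ^ k - rho * eps ^ 2 / 3 := by
    intro k hk hk2
    have a1 := hcon k hk hk2
    have a2 : eps ^ 2 ≤ ‖r k‖ ^ 2 := pow_le_pow_left₀ heps.le a1.le 2
    have a3 := mul_le_mul_of_nonneg_left a2 hrho.le
    have a4 : 0 ≤ eps0 * alpha ^ k := by positivity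
    unfold epsFALM
    linarith
  have hind : ∀ k ≤ N, En k ≤ ‖z‖ ^ 2 / 2 +
      eps0 * ∑ i ∈ Finset.range k, B (i + 1) * alpha ^ i := by
    intro k
    induction k with
    | zero =>
      intro _
      rw [hEn, hB0, hnu0, (hseq 0).2.1, hB0]
      simp
      linarith
    | succ k ih =>
      intro hk
      have ihk := ih (by omega)
      have hkR : En k ≤ R ^ 2 / 2 := by linarith [hR k]
      have hst := hstep k hkR
      have hb : epsFALM eps0 alpha (1 / 4) rho eps k + rho * eps ^ 2 * (16 / 2025) -
        2 / 5 * rho * ‖r k‖ ^ 2 ≤ eps0 * alpha ^ k := by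
        by_cases hc : epsFALM eps0 alpha (1 / 4) rho eps k ≤ D * eps / 2
        · linarith [hr2 k (by omega) hc]
        · push Not at hc
          have a0 : eps ≤ D * eps := le_mul_of_one_le_left heps.le hD1
          have a1 : 0 ≤ 2 / 5 * rho * ‖r k‖ ^ 2 := by positivity
          have a2 : rho * eps ^ 2 ≤ eps := by
            calc rho * eps ^ 2 = (rho * eps) * eps := by ring
              _ ≤ 1 * eps := mul_le_mul_of_nonneg_right hrhoeps heps.le
              _ = eps := one_mul _
          unfold epsFALM at hc ⊢
          linarith
      have hb2 := mul_le_mul_of_nonneg_left hb (hBpos (k + 1))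
      rw [Finset.sum_range_succ]
      linarith
  have h1 := hind N le_rfl
  have h2 := hstep N (by linarith [hR N])
  have h3 := mul_le_mul_of_nonneg_left (hr2 N le_rfl hN1) (hBpos (N + 1))
  have h4 := hR (N + 1)
  rw [Finset.sum_range_succ] at h4
  have h5 := hEpos (N + 1)
  have h6 := sq_nonneg ‖nu (N + 1) - z‖
  linarith
/-! ### Constants -/

/-- numerical constant `Σ (i+1)² (9/10)^i` -/
def Sconst : ℝ := ∑' i : ℕ, ((i : ℝ) + 1) ^ 2 * (9 / 10 : ℝ) ^ i

lemma Sconst_summable : Summable (fun i : ℕ => ((i : ℝ) + 1) ^ 2 * (9 / 10 : ℝ) ^ i) := by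
  have h := fun k => summable_pow_mul_geometric_of_norm_lt_one (R := ℝ) k
    (r := 9 / 10) (by norm_num [abs_of_pos])
  have := ((h 2).add ((h 1).mul_left 2)).add (h 0)
  refine this.congr ?_
  intro i
  ring

lemma Sconst_nonneg : 0 ≤ Sconst := tsum_nonneg fun i => by positivity

lemma C_bound {B : ℕ → ℝ} {rho q alpha : ℝ} (hq : 0 ≤ q) (ha : 0 ≤ alpha)
    (hal : alpha ≤ 9 / 10 * ((1 + q) ^ 2)⁻¹) (hrho : 0 ≤ rho)
    (hB : ∀ k : ℕ, B (k + 1) ≤ rho * (((k : ℝ) + 1) * (1 + q) ^ k) ^ 2)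
    (hsum : Summable (fun i : ℕ => B (i + 1) * alpha ^ i)) :
    ∑' i : ℕ, B (i + 1) * alpha ^ i ≤ rho * Sconst := by
  unfold Sconst
  rw [← tsum_mul_left]
  refine Summable.tsum_le_tsum ?_ hsum (Sconst_summable.mul_left _)
  intro i
  have h1 : alpha ^ i ≤ (9 / 10) ^ i * (((1 + q) ^ 2) ^ i)⁻¹ := by
    calc _ ≤ (9 / 10 * ((1 + q) ^ 2)⁻¹) ^ i := pow_le_pow_left₀ ha hal i
      _ = _ := by rw [mul_pow, inv_pow]
  have hp : 0 < (1 + q) ^ i := by positivity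
  calc B (i + 1) * alpha ^ i ≤ (rho * (((i : ℝ) + 1) * (1 + q) ^ i) ^ 2) * alpha ^ i :=
        mul_le_mul_of_nonneg_right (hB i) (by positivity)
    _ ≤ (rho * (((i : ℝ) + 1) * (1 + q) ^ i) ^ 2) * ((9 / 10) ^ i * (((1 + q) ^ 2) ^ i)⁻¹) :=
        mul_le_mul_of_nonneg_left h1 (by positivity)
    _ = _ := by
      rw [← pow_mul, mul_comm 2 i, pow_mul, mul_pow (_ + _)]
      field_simp

lemma gd_bounds {gd eps R : ℝ} (heps : 0 < eps) (hR : 1 ≤ R)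
    (hgd : gd = (1 / 4 : ℝ) ^ ((3 : ℝ) / 2) * eps /
      (Real.sqrt 3 * (R * (2 / Real.sqrt (1 - 1 / 4) + 1)))) :
    0 < gd ∧ eps / 46 ≤ gd * R ∧ gd * R ≤ eps / 45 := by
  have e1 : (1 / 4 : ℝ) ^ ((3 : ℝ) / 2) = 1 / 8 := by
    have : (1 / 4 : ℝ) = (1 / 2) ^ (2 : ℝ) := by norm_num
    rw [this, ← Real.rpow_mul (by norm_num)]
    norm_num
  have e2 : Real.sqrt (1 - 1 / 4) = Real.sqrt 3 / 2 := by
    rw [show (1 - 1 / 4 : ℝ) = 3 / 2 ^ 2 by norm_num, Real.sqrt_div (by norm_num),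
      Real.sqrt_sq (by norm_num)]
  have s3 : Real.sqrt 3 ^ 2 = 3 := Real.sq_sqrt (by norm_num)
  have s0 : 0 < Real.sqrt 3 := by positivity
  have e3 : gd * R = eps / (32 + 8 * Real.sqrt 3) := by
    rw [hgd, e1, e2]
    field_simp
    ring
  have l1 : 1.7 ≤ Real.sqrt 3 := Real.le_sqrt_of_sq_le (by norm_num)
  have l2 : Real.sqrt 3 ≤ 1.74 := by
    rw [Real.sqrt_le_left (by norm_num)]; norm_num
  refine ⟨?_, ?_, ?_⟩
  · rw [hgd, e1, e2]; positivity
  · rw [e3]; exact div_le_div_of_nonneg_left heps.le (by linarith) (by norm_num at l2 ⊢; linarith)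
  · rw [e3]; exact div_le_div_of_nonneg_left heps.le (by norm_num) (by norm_num at l1 ⊢; linarith)

lemma Rt_bound {domh : Set (Euc n)} {F : Euc n → ℝ}
    {A : Euc n →L[ℝ] Euc m} {bvec lamstar lamt : Euc m} {gp gd eps D w Rt Rl : ℝ} {x0 : Euc n}
    {d dt : Euc m → ℝ}
    (hgp : gp = eps / (2 * D)) (hD : 1 ≤ D) (hgd : 0 < gd) (heps : 0 < eps)
    (hw : 0 ≤ w)
    (hx0 : x0 ∈ domh) (hdiam : ∀ u ∈ domh, ∀ w ∈ domh, ‖u - w‖ ≤ D)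
    (hd : ∀ lam : Euc m,
            IsLeast ((fun x => F x + ⟪lam, A x - bvec⟫) '' domh) (d lam))
    (hdmax : ∀ nu' : Euc m, d nu' ≤ d lamstar)
    (hdt : ∀ lam : Euc m,
            IsLeast
              ((fun x => F x + ⟪lam, A x - bvec⟫ + gp / 2 * ‖x - x0‖ ^ 2) '' domh)
              (dt lam + gd / 2 * ‖lam‖ ^ 2))
    (hdtmax : ∀ nu' : Euc m, dt nu' ≤ dt lamt)
    (hRl : Rl = max 1 ‖lamstar‖) (hRt : Rt = max 1 ‖lamt‖)
    (hlow : eps / 46 ≤ gd * (Rt * w)) :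
    Rt ≤ Rl + 23 * w * D := by
  have hD0 : 0 < D := by linarith
  have hgp0 : 0 < gp := by rw [hgp]; positivity
  have h1 : d lamstar ≤ dt lamstar + gd / 2 * ‖lamstar‖ ^ 2 := by
    obtain ⟨x, hx, hxe⟩ := (hdt lamstar).1
    have := (hd lamstar).2 ⟨x, hx, rfl⟩
    simp only at hxe this
    have : 0 ≤ gp / 2 * ‖x - x0‖ ^ 2 := by positivity
    linarith
  have h2 : dt lamt + gd / 2 * ‖lamt‖ ^ 2 ≤ d lamt + gp / 2 * D ^ 2 := by
    obtain ⟨x, hx, hxe⟩ := (hd lamt).1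
    have := (hdt lamt).2 ⟨x, hx, rfl⟩
    simp only at hxe this
    have a1 : gp / 2 * ‖x - x0‖ ^ 2 ≤ gp / 2 * D ^ 2 :=
      mul_le_mul_of_nonneg_left (pow_le_pow_left₀ (norm_nonneg _) (hdiam _ hx _ hx0) 2)
        (by positivity)
    linarith
  have h3 := hdmax lamt
  have h4 := hdtmax lamstar
  have e1 : gp * D ^ 2 = eps * D / 2 := by rw [hgp]; field_simp
  have h5 : gd * ‖lamt‖ ^ 2 ≤ gd * (‖lamstar‖ ^ 2 + 23 * w * D * Rt) := by
    have := mul_le_mul_of_nonneg_right hlow hD0.le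
    linarith
  have h6 := le_of_mul_le_mul_left h5 hgd
  have r1 : 1 ≤ Rl := hRl ▸ le_max_left _ _
  have r2 : 1 ≤ Rt := hRt ▸ le_max_left _ _
  have r3 : ‖lamstar‖ ≤ Rl := hRl ▸ le_max_right _ _
  have hwD : 0 ≤ w * D := by positivity
  rcases max_choice 1 ‖lamt‖ with hc | hc
  · rw [hRt, hc]; linarith
  · rw [← hRt] at hc
    rw [← hc] at h6
    have a1 : ‖lamstar‖ ^ 2 ≤ Rl ^ 2 := pow_le_pow_left₀ (norm_nonneg _) r3 2
    by_contra hcon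
    push Not at hcon
    have a2 := mul_lt_mul_of_pos_right hcon (show 0 < Rt by linarith)
    have a3 : Rl * Rl ≤ Rl * Rt := mul_le_mul_of_nonneg_left (by linarith) (by linarith)
    linarith
/-! ### Logarithmic bounds -/

lemma le_exp_of_abs_log {x l : ℝ} (hx : 0 < x) (h : |Real.log x| ≤ l) :
    x ≤ Real.exp l ∧ x⁻¹ ≤ Real.exp l := by
  have h1 := le_abs_self (Real.log x)
  have h2 := neg_le_abs (Real.log x)
  constructor
  · rw [← Real.log_le_iff_le_exp hx]; linarith
  · rw [← Real.log_le_iff_le_exp (inv_pos.mpr hx), Real.log_inv]; linarith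

lemma exp7 : (963 : ℝ) ≤ Real.exp 7 := by
  have h := Real.exp_one_gt_d9
  have e : Real.exp 7 = Real.exp 1 ^ 7 := by rw [← Real.exp_nat_mul]; norm_num
  rw [e]
  calc (963 : ℝ) ≤ 2.7 ^ 7 := by norm_num
    _ ≤ _ := pow_le_pow_left₀ (by norm_num) (by norm_num at h ⊢; linarith) 7

lemma inner_T {Lf a eps D rho e mu L l : ℝ} (hLf : 0 < Lf) (ha : 0 < a) (heps : 0 < eps)
    (hD1 : 1 ≤ D) (hrho : rho = Lf / a ^ 2) (he : rho * eps ^ 2 / 32 ≤ e)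
    (hmu : mu = eps / (2 * D) + e / (4 * D ^ 2)) (hL : L = Lf + rho * a ^ 2) (hl : 1 ≤ l)
    (bD : D ≤ Real.exp l) (ba : a ≤ Real.exp l) (be : eps⁻¹ ≤ Real.exp l)
    (bL : Lf⁻¹ ≤ Real.exp l) : 12 * (L + mu) * D ^ 2 / e ≤ Real.exp (13 * l) := by
  have hD0 : 0 < D := by linarith
  have hrho0 : 0 < rho := by rw [hrho]; positivity
  have hp : 0 < rho * eps ^ 2 / 32 := by positivity
  have he0 : 0 < e := by linarith
  have e1 : L = 2 * Lf := by rw [hL, hrho]; field_simp; norm_num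
  have e2 : 12 * (L + mu) * D ^ 2 / e = (24 * Lf * D ^ 2 + 6 * eps * D) / e + 3 := by
    rw [e1, hmu]; field_simp; ring
  have e3 : (24 * Lf * D ^ 2 + 6 * eps * D) / e ≤
      (24 * Lf * D ^ 2 + 6 * eps * D) / (rho * eps ^ 2 / 32) :=
    div_le_div_of_nonneg_left (by positivity) hp he
  have e4 : (24 * Lf * D ^ 2 + 6 * eps * D) / (rho * eps ^ 2 / 32) =
      768 * (D * D * a * a * eps⁻¹ * eps⁻¹) + 192 * (D * a * a * Lf⁻¹ * eps⁻¹) := by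
    rw [hrho]; field_simp; ring
  set X := Real.exp l
  have hX : 1 ≤ X := Real.one_le_exp (by linarith)
  have b1 : D * D * a * a * eps⁻¹ * eps⁻¹ ≤ X * X * X * X * X * X := by gcongr
  have b2 : D * a * a * Lf⁻¹ * eps⁻¹ ≤ X * X * X * X * X := by gcongr
  have b3 : X * X * X * X * X ≤ X * X * X * X * X * X :=
    le_mul_of_one_le_right (by positivity) hX
  have b4 : 1 ≤ X * X * X * X * X * X := by
    calc (1 : ℝ) ≤ X ^ 6 := one_le_pow₀ hX
      _ = _ := by ring
  have b5 : Real.exp (13 * l) = Real.exp (7 * l) * (X * X * X * X * X * X) := by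
    have : X * X * X * X * X * X = Real.exp (6 * l) := by
      simp only [X, ← Real.exp_add]; congr 1; ring
    rw [this, ← Real.exp_add]; congr 1; ring
  have b6 : 963 ≤ Real.exp (7 * l) := exp7.trans (Real.exp_le_exp.mpr (by linarith))
  have b7 := mul_le_mul_of_nonneg_right b6 (show 0 ≤ X * X * X * X * X * X by positivity)
  rw [e2, b5]
  linarith

lemma rho_inv {Lf a eps rho l : ℝ} (hLf : 0 < Lf) (ha : 0 < a) (heps : 0 < eps)
    (hrho : rho = Lf / a ^ 2)
    (ba : a ≤ Real.exp l) (be : eps⁻¹ ≤ Real.exp l)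
    (bL : Lf⁻¹ ≤ Real.exp l) : 1 ≤ Real.exp (4 * l) * (rho * eps) := by
  have e1 : a * a * Lf⁻¹ * eps⁻¹ * (rho * eps) = 1 := by rw [hrho]; field_simp
  have b1 : a * a * Lf⁻¹ * eps⁻¹ ≤ Real.exp l * Real.exp l * Real.exp l * Real.exp l := by gcongr
  have b2 : Real.exp (4 * l) = Real.exp l * Real.exp l * Real.exp l * Real.exp l := by
    simp only [← Real.exp_add]; congr 1; ring
  rw [b2, ← e1]
  have : 0 < rho * eps := by rw [hrho]; positivity
  exact mul_le_mul_of_nonneg_right b1 this.le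

lemma N_first {alpha rho eps D l : ℝ} {N : ℕ} (ha : 0 ≤ alpha) (ha9 : alpha ≤ 9 / 10)
    (hrho : 0 < rho) (heps : 0 < eps) (hre : rho * eps ≤ 1) (hD1 : 1 ≤ D) (hl : 1 ≤ l)
    (hinv : 1 ≤ Real.exp (4 * l) * (rho * eps)) (hN : 50 * l ≤ N) :
    epsFALM rho⁻¹ alpha (1 / 4) rho eps N ≤ D * eps / 2 := by
  have p1 := pow_large (s := 1 / 9) (t := 5 * l) (by norm_num) N (by linarith) (by linarith)
  have p2 : alpha ^ N * (1 + 1 / 9) ^ N ≤ 1 := by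
    rw [← mul_pow]
    exact pow_le_one₀ (by positivity) (by linarith)
  have p3 : Real.exp (5 * l) = Real.exp l * Real.exp (4 * l) := by
    rw [← Real.exp_add]; congr 1; ring
  have p4 : 2 ≤ Real.exp l := by
    have := Real.add_one_le_exp l; linarith
  have hN0 : 0 ≤ alpha ^ N := by positivity
  have q1 : alpha ^ N * Real.exp (5 * l) ≤ 1 :=
    (mul_le_mul_of_nonneg_left p1 hN0).trans p2
  have hre0 : 0 < rho * eps := by positivity
  have q2 : alpha ^ N * 2 ≤ rho * eps := by
    have q3 : 2 ≤ Real.exp (5 * l) * (rho * eps) := by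
      rw [p3, mul_assoc]
      calc (2 : ℝ) = 2 * 1 := by norm_num
        _ ≤ _ := mul_le_mul p4 hinv (by norm_num) (by positivity)
    calc alpha ^ N * 2 ≤ alpha ^ N * (Real.exp (5 * l) * (rho * eps)) :=
          mul_le_mul_of_nonneg_left q3 hN0
      _ = (alpha ^ N * Real.exp (5 * l)) * (rho * eps) := by ring
      _ ≤ 1 * (rho * eps) := mul_le_mul_of_nonneg_right q1 hre0.le
      _ = _ := one_mul _
  have q4 : rho⁻¹ * alpha ^ N ≤ eps / 2 := by
    rw [inv_mul_le_iff₀ hrho]; linarith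
  have q5 : rho * eps ^ 2 ≤ eps := by
    calc rho * eps ^ 2 = (rho * eps) * eps := by ring
      _ ≤ 1 * eps := mul_le_mul_of_nonneg_right hre heps.le
      _ = eps := one_mul _
  have a0 : eps ≤ D * eps := le_mul_of_one_le_left heps.le hD1
  unfold epsFALM
  linarith

lemma N_second {q rho eps l R w1 Bn D Rl : ℝ} {N : ℕ} (hq : 0 < q)
    (hrho : 0 < rho) (heps : 0 < eps) (hl : 1 ≤ l) (hw1 : 1 ≤ w1)
    (hR1 : 1 ≤ R) (hR : R ≤ 23 * w1 ^ 2 * (Rl + D)) (bD : D ≤ Real.exp l) (bR : Rl ≤ Real.exp l)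
    (hinv : 1 ≤ Real.exp (4 * l) * (rho * eps))
    (hB : rho * ((1 + q / 2) ^ N) ^ 2 ≤ Bn)
    (hN : (5 + Real.log (60 * w1 ^ 2)) * l * (1 + 1 / (q / 2)) ≤ N) :
    R ^ 2 / 2 < Bn * (rho * eps ^ 2 / 3) := by
  have hlog : 0 ≤ Real.log (60 * w1 ^ 2) := Real.log_nonneg (by nlinarith)
  have p1 := pow_large (s := q / 2) (by linarith) N hN (by positivity)
  set Q := (1 + q / 2) ^ N
  have p2 : 60 * w1 ^ 2 * Real.exp (5 * l) ≤ Q := by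
    refine le_trans ?_ p1
    rw [← Real.exp_log (show 0 < 60 * w1 ^ 2 by positivity), ← Real.exp_add, Real.exp_le_exp,
      Real.exp_log (show 0 < 60 * w1 ^ 2 by positivity)]
    nlinarith
  have p3 : Real.exp (5 * l) = Real.exp l * Real.exp (4 * l) := by
    rw [← Real.exp_add]; congr 1; ring
  have hre0 : 0 < rho * eps := by positivity
  have hX : 0 < Real.exp l := Real.exp_pos l
  have p4 : 60 * w1 ^ 2 * Real.exp l ≤ Q * (rho * eps) := by
    calc 60 * w1 ^ 2 * Real.exp l = 60 * w1 ^ 2 * Real.exp l * 1 := by ring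
      _ ≤ 60 * w1 ^ 2 * Real.exp l * (Real.exp (4 * l) * (rho * eps)) :=
        mul_le_mul_of_nonneg_left hinv (by positivity)
      _ = 60 * w1 ^ 2 * Real.exp (5 * l) * (rho * eps) := by rw [p3]; ring
      _ ≤ _ := mul_le_mul_of_nonneg_right p2 hre0.le
  have p5 : R ≤ 46 * w1 ^ 2 * Real.exp l := by
    calc R ≤ _ := hR
      _ ≤ 23 * w1 ^ 2 * (Real.exp l + Real.exp l) := by gcongr
      _ = _ := by ring
  have p6 : 60 / 46 * R ≤ Q * (rho * eps) := by linarith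
  have p7 : (60 / 46 * R) ^ 2 ≤ (Q * (rho * eps)) ^ 2 := pow_le_pow_left₀ (by linarith) p6 2
  have p8 : (Q * (rho * eps)) ^ 2 / 3 ≤ Bn * (rho * eps ^ 2 / 3) := by
    have := mul_le_mul_of_nonneg_right hB (show 0 ≤ rho * eps ^ 2 / 3 by positivity)
    calc _ = rho * Q ^ 2 * (rho * eps ^ 2 / 3) := by ring
      _ ≤ _ := this
  have p9 : 0 < R ^ 2 := by positivity
  nlinarith
lemma final_sum {J : ℕ → ℕ} {K N : ℕ} {l X Y c1 : ℝ} (hK : K ≤ N) (hl : 1 ≤ l) (hX : 0 ≤ X)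
    (hJ : ∀ k, (J k : ℝ) ≤ 13 * l * (1 + 6 * X) + 1)
    (hN : (N : ℝ) + 1 ≤ c1 * l * (1 + Y)) :
    (∑ k ∈ Finset.range (K + 1), ((J k : ℝ) + 1)) ≤ 93 * c1 * l ^ 2 * ((1 + X) * (1 + Y)) := by
  have h1 : (∑ k ∈ Finset.range (K + 1), ((J k : ℝ) + 1)) ≤ (K + 1 : ℝ) * (93 * l * (1 + X)) := by
    have : ∀ k ∈ Finset.range (K + 1), ((J k : ℝ) + 1) ≤ 93 * l * (1 + X) := by
      intro k _
      have := hJ k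
      have := mul_nonneg (show 0 ≤ l by linarith) hX
      linarith
    have h := Finset.sum_le_card_nsmul _ _ _ this
    rw [Finset.card_range, nsmul_eq_mul] at h
    push_cast at h
    exact h
  have h2 : (K : ℝ) + 1 ≤ c1 * l * (1 + Y) := by
    have : (K : ℝ) ≤ N := by exact_mod_cast hK
    linarith
  have h3 := mul_le_mul_of_nonneg_right h2 (show 0 ≤ 93 * l * (1 + X) by positivity)
  calc _ ≤ _ := h1
    _ ≤ _ := h3
    _ = _ := by ring

/-- the numerical constant `1 + √(2S)` -/
def wconst : ℝ := 1 + Real.sqrt (2 * Sconst)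

lemma one_le_wconst : 1 ≤ wconst := by unfold wconst; linarith [Real.sqrt_nonneg (2 * Sconst)]

def cconst : ℝ := 52 + (5 + Real.log (60 * wconst ^ 2)) +
  66 * (5 + Real.log (60 * wconst ^ 2)) * wconst

lemma wlog_nonneg : 0 ≤ Real.log (60 * wconst ^ 2) :=
  Real.log_nonneg (by nlinarith [one_le_wconst])

lemma XY_id {D Lf Rl a eps : ℝ} (hD : 0 < D) (hLf : 0 < Lf) (heps : 0 < eps)
    (hRl : 0 ≤ Rl) :
    (1 + Real.sqrt (D * Lf) / Real.sqrt eps) *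
      (1 + Real.sqrt (D + Rl) * a / Real.sqrt (Lf * eps)) =
    1 + Real.sqrt (D ^ 2 + D * Rl) * a / eps +
                Real.sqrt (D + Rl) * a / Real.sqrt (Lf * eps) +
                Real.sqrt (D * Lf) / Real.sqrt eps := by
  have e1 : Real.sqrt (D ^ 2 + D * Rl) = Real.sqrt D * Real.sqrt (D + Rl) := by
    rw [← Real.sqrt_mul hD.le]; congr 1; ring
  have e2 : Real.sqrt (D * Lf) = Real.sqrt D * Real.sqrt Lf := Real.sqrt_mul hD.le _
  have e3 : Real.sqrt (Lf * eps) = Real.sqrt Lf * Real.sqrt eps := Real.sqrt_mul hLf.le _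
  have e4 : eps = Real.sqrt eps * Real.sqrt eps := (Real.mul_self_sqrt heps.le).symm
  have s1 : 0 < Real.sqrt Lf := Real.sqrt_pos.mpr hLf
  have s2 : 0 < Real.sqrt eps := Real.sqrt_pos.mpr heps
  have e5 : Real.sqrt (D ^ 2 + D * Rl) * a / eps =
      (Real.sqrt (D * Lf) / Real.sqrt eps) * (Real.sqrt (D + Rl) * a / Real.sqrt (Lf * eps)) := by
    rw [e1, e2, e3]
    nth_rewrite 1 [e4]
    field_simp
  rw [e5]; ring

lemma s_bound {D Lf eps L mu X : ℝ} (hD : 0 < D) (hLf : 0 < Lf) (heps : 0 < eps)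
    (hX : X = Real.sqrt (D * Lf) / Real.sqrt eps) (hL : L = 2 * Lf) (hmu : eps / (2 * D) ≤ mu) :
    0 < 1 / (6 * X) ∧ 1 / (6 * X) ≤ Real.sqrt ((2 * L)⁻¹ * mu) / 2 := by
  have hX0 : 0 < X := by rw [hX]; positivity
  refine ⟨by positivity, ?_⟩
  have h1 : 1 / (3 * X) ≤ Real.sqrt ((2 * L)⁻¹ * mu) := by
    apply Real.le_sqrt_of_sq_le
    have hX2 : X ^ 2 = D * Lf / eps := by
      rw [hX, div_pow, Real.sq_sqrt (by positivity), Real.sq_sqrt heps.le]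
    have e1 : (1 / (3 * X)) ^ 2 = eps / (9 * D * Lf) := by
      rw [div_pow, mul_pow, hX2]; field_simp; norm_num
    rw [e1, hL]
    have e2 : eps / (9 * D * Lf) ≤ (2 * (2 * Lf))⁻¹ * (eps / (2 * D)) := by
      have : (2 * (2 * Lf))⁻¹ * (eps / (2 * D)) = eps / (8 * D * Lf) := by field_simp; norm_num
      rw [this]
      apply div_le_div_of_nonneg_left heps.le (by positivity)
      have : 0 < D * Lf := by positivity
      linarith
    exact e2.trans (mul_le_mul_of_nonneg_left hmu (by positivity))
  have e3 : 1 / (6 * X) = 1 / (3 * X) / 2 := by field_simp; norm_num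
  rw [e3]; linarith

lemma q_bound {D Lf Rl a eps rho gd R w1 q Y : ℝ} (hD : 0 < D) (hLf : 0 < Lf) (ha : 0 < a)
    (heps : 0 < eps) (hRl : 0 ≤ Rl) (hrho : rho = Lf / a ^ 2) (hgd : 0 < gd)
    (hlow : eps / 46 ≤ gd * R) (hw1 : 1 ≤ w1) (hR1 : 1 ≤ R) (hR : R ≤ 23 * w1 ^ 2 * (Rl + D))
    (hq : q = Real.sqrt (rho * gd)) (hY : Y = Real.sqrt (D + Rl) * a / Real.sqrt (Lf * eps)) :
    0 < q ∧ 1 / (q / 2) ≤ 66 * w1 * Y := by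
  have hrho0 : 0 < rho := by rw [hrho]; positivity
  have hq0 : 0 < q := by rw [hq]; positivity
  have hY0 : 0 < Y := by rw [hY]; positivity
  refine ⟨hq0, ?_⟩
  have hq2 : q ^ 2 = rho * gd := by rw [hq, Real.sq_sqrt (by positivity)]
  have hY2 : Y ^ 2 * (rho * eps) = D + Rl := by
    rw [hY, div_pow, mul_pow, Real.sq_sqrt (by positivity), Real.sq_sqrt (by positivity), hrho]
    field_simp
  have h1 : 1 ≤ 33 * w1 * Y * q := by
    refine le_of_sq_le_sq ?_ (by positivity)
    have e1 : (33 * w1 * Y * q) ^ 2 = 1089 * w1 ^ 2 * Y ^ 2 * rho * gd := by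
      rw [mul_pow, mul_pow, mul_pow, hq2]; ring
    have h2 : Y ^ 2 * (rho * eps) ≤ Y ^ 2 * (rho * (46 * (gd * R))) :=
      mul_le_mul_of_nonneg_left (mul_le_mul_of_nonneg_left (by linarith) hrho0.le) (by positivity)
    have hp : 0 ≤ Y ^ 2 * rho * gd := by positivity
    have h3 := mul_le_mul_of_nonneg_left hR hp
    have hs : 0 < D + Rl := by positivity
    rw [hY2] at h2
    have h4 : (D + Rl) * 1 ≤ (D + Rl) * (1058 * w1 ^ 2 * (Y ^ 2 * rho * gd)) := by linarith
    have h5 := le_of_mul_le_mul_left h4 hs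
    have h6 : 0 ≤ w1 ^ 2 * (Y ^ 2 * rho * gd) := by positivity
    rw [e1]; linarith
  rw [div_le_iff₀ (by linarith)]
  linarith

lemma rpow_le {l c b : ℝ} (hl : 1 ≤ l) (hc : 2 ≤ c) (hb : 0 ≤ b) :
    c * l ^ 2 * b ≤ c * l ^ c * b := by
  have : l ^ 2 ≤ l ^ c := by
    rw [← Real.rpow_natCast]; exact Real.rpow_le_rpow_of_exponent_le hl (by exact_mod_cast hc)
  gcongr
/-!
STATEMENT 6 (Theorem: total iteration-complexity of the I-FALM).
-/

theorem ifalm_complexity :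
    ∃ c : ℝ, 0 < c ∧
      ∀ (n m : ℕ) (domh : Set (Euc n)) (f h : Euc n → ℝ) (f' : Euc n → Euc n)
        (A : Euc n →L[ℝ] Euc m) (bvec : Euc m)
        (Lf D eps eps0 alpha sigma rho gp gd calR : ℝ)
        -- standing assumptions
        (_ : 0 < Lf) (_ : ConvexOn ℝ Set.univ f) (_ : HasLipGrad f f' Lf)
        (_ : LowerSemicontinuous f)
        (_ : ConvexOn ℝ domh h) (_ : IsClosed domh)
        (_ : LowerSemicontinuousOn h domh) (_ : domh.Nonempty)
        (_ : ∃ xs ∈ intrinsicInterior ℝ domh, A xs = bvec)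
        (_ : 1 ≤ D) (_ : ∀ u ∈ domh, ∀ w ∈ domh, ‖u - w‖ ≤ D)
        -- target accuracy
        (_ : 0 < eps) (_ : eps ≤ ‖A‖ ^ 2 / Lf)
        -- a run of Algorithm 6
        (x0c : Euc n) (xseq : ℕ → Euc n) (lamseq nu nut : ℕ → Euc m)
        (bo Bo tauo : ℕ → ℝ)
        (xin yin xtin ytin : ℕ → ℕ → Euc n) (ain Ain tauin : ℕ → ℕ → ℝ)
        (P Gm : ℕ → ℕ → Euc n) (J : ℕ → ℕ)
        (_ : FALMSpec domh f h f' A bvec Lf D rho eps eps0 alpha sigma gp gd x0c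
            xseq lamseq nu nut bo Bo tauo xin yin xtin ytin ain Ain tauin P Gm J)
        -- the Lagrangian dual, its minimum-norm maximizer, and `R̂_Λ`
        (d : Euc m → ℝ)
        (_ : ∀ lam : Euc m,
            IsLeast ((fun x => f x + h x + ⟪lam, A x - bvec⟫) '' domh) (d lam))
        (lamstar : Euc m) (RhatLam : ℝ)
        (_ : ∀ nu' : Euc m, d nu' ≤ d lamstar)
        (_ : ∀ lam' : Euc m, (∀ nu', d nu' ≤ d lam') → ‖lamstar‖ ≤ ‖lam'‖)
        (_ : RhatLam = max 1 ‖lamstar‖)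
        -- the perturbed dual `d̃`, its maximizer, and `R̂_Λ̃`
        (dt : Euc m → ℝ) (lamt : Euc m) (RhatTil : ℝ)
        (_ : ∀ lam : Euc m,
            IsLeast
              ((fun x => f x + h x + ⟪lam, A x - bvec⟫ + gp / 2 * ‖x - x0c‖ ^ 2) '' domh)
              (dt lam + gd / 2 * ‖lam‖ ^ 2))
        (_ : ∀ nu' : Euc m, dt nu' ≤ dt lamt)
        (_ : RhatTil = max 1 ‖lamt‖)
        -- `C = Σ_{i≥0} B_{i+1} αⁱ < ∞` and `𝓡`
        (_ : Summable (fun i : ℕ => Bo (i + 1) * alpha ^ i))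
        (_ : calR = RhatTil * (1 + Real.sqrt (2 * eps0 * ∑' i : ℕ, Bo (i + 1) * alpha ^ i)) *
            (2 / Real.sqrt (1 - sigma) + 1))
        -- parameter choices of the theorem
        (_ : rho = Lf / ‖A‖ ^ 2) (_ : eps0 = rho⁻¹) (_ : sigma = 1 / 4)
        (_ : gp = eps / (2 * D))
        (_ : gd = sigma ^ ((3 : ℝ) / 2) * eps / (Real.sqrt 3 * calR))
        (_ : 0 ≤ alpha)
        (_ : alpha ≤ min (9 / 10 * ((1 + Real.sqrt (rho * gd)) ^ 2)⁻¹)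
            ((15 * D * eps / (28 * eps0)) ^ Real.sqrt (rho * eps / D))),
        ∃ K : ℕ,
          -- `(x_{K+1}, λ_{K+1})` is an `ε`-primal-dual solution
          (∃ v ∈ subdiffOn domh
              (fun u => f u + h u + ⟪lamseq (K + 1), A u - bvec⟫) (xseq (K + 1)),
            ‖v‖ ≤ eps) ∧
          ‖A (xseq (K + 1)) - bvec‖ ≤ eps ∧
          -- total number of ACG iterations
          (∑ k ∈ Finset.range (K + 1), ((J k : ℝ) + 1)) ≤
            c * (1 + |Real.log D| + |Real.log Lf| + |Real.log ‖A‖| +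
                |Real.log eps| + |Real.log (1 - alpha)| + |Real.log RhatLam|) ^ c *
              (1 + Real.sqrt (D ^ 2 + D * RhatLam) * ‖A‖ / eps +
                Real.sqrt (D + RhatLam) * ‖A‖ / Real.sqrt (Lf * eps) +
                Real.sqrt (D * Lf) / Real.sqrt eps) := by
  refine ⟨93 * cconst, ?_, ?_⟩
  · have := wlog_nonneg
    have := one_le_wconst
    unfold cconst; positivity
  intro n m domh f h f' A bvec Lf D eps eps0 alpha sigma rho gp gd calR hLf hfc hf _ hh hcl hlsc
    hne _ hD1 hdiam heps hepsle x0c xseq lamseq nu nut bo Bo tauo xin yin xtin ytin ain Ain tauin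
    P Gm J hspec d hd lamstar RhatLam hdmax _ hRl dt lamt RhatTil hdt hdtmax hRt hsum hcalR
    hrho heps0 hsigma hgp hgd halpha hal
  subst hsigma
  obtain ⟨sB0, st0, slam0, snu0, sx0, sbo, sBo, stau, snut, sACG, sP, sGm, sGle, sJ, sx, slam,
    snu⟩ := hspec
  -- basic positivity
  have hD0 : 0 < D := by linarith
  have hA0 : 0 < ‖A‖ := by
    rcases (norm_nonneg A).eq_or_lt with h0 | h0
    · rw [← h0] at hepsle; norm_num at hepsle; linarith
    · exact h0
  have hrho0 : 0 < rho := by rw [hrho]; positivity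
  have hre : rho * eps ≤ 1 := by
    calc rho * eps ≤ rho * (‖A‖ ^ 2 / Lf) := mul_le_mul_of_nonneg_left hepsle hrho0.le
      _ = 1 := by rw [hrho]; field_simp
  have heps00 : 0 < eps0 := by rw [heps0]; positivity
  have hgp0 : 0 < gp := by rw [hgp]; positivity
  have hx0d : x0c ∈ domh := by rw [sx0]; exact (sACG 0).2.2.2.2.1
  have hRl1 : 1 ≤ RhatLam := hRl ▸ le_max_left _ _
  have hRt1 : 1 ≤ RhatTil := hRt ▸ le_max_left _ _
  -- the tolerance
  have hek : ∀ k, rho * eps ^ 2 / 32 ≤ epsFALM eps0 alpha (1 / 4) rho eps k := by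
    intro k
    have : 0 ≤ eps0 * alpha ^ k := by positivity
    unfold epsFALM
    linarith
  have hek0 : ∀ k, 0 < epsFALM eps0 alpha (1 / 4) rho eps k := fun k =>
    lt_of_lt_of_le (by positivity) (hek k)
  -- constants
  set w := 1 + Real.sqrt (2 * eps0 * ∑' i : ℕ, Bo (i + 1) * alpha ^ i) with hw
  have hw1 : 1 ≤ w := by rw [hw]; linarith [Real.sqrt_nonneg (2 * eps0 * ∑' i : ℕ, Bo (i + 1) * alpha ^ i)]
  set R := RhatTil * w with hRdef
  have hR1 : 1 ≤ R := one_le_mul_of_one_le_of_one_le hRt1 hw1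
  rw [hcalR] at hgd
  obtain ⟨hgd0, hgdlow, hgdup⟩ := gd_bounds heps hR1 hgd
  have hseq := seq_basic hrho0 hgd0.le sB0 st0 sbo sBo
    (fun k => by rw [stau k]; ring)
  have hgr := seq_growth hrho0 hgd0.le sB0 sBo hseq
  set q := Real.sqrt (rho * gd) with hq
  have hal1 := hal.trans (min_le_left _ _)
  have hBpos : ∀ k, 0 ≤ Bo k := fun k => (hseq k).1
  have hCle := C_bound (Real.sqrt_nonneg _) halpha hal1 hrho0.le (fun k => (hgr k).2) hsum
  have hC0 : 0 ≤ ∑' i : ℕ, Bo (i + 1) * alpha ^ i :=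
    tsum_nonneg fun i => mul_nonneg (hBpos _) (by positivity)
  have hwle : w ≤ wconst := by
    rw [hw, wconst]
    have : 2 * eps0 * ∑' i : ℕ, Bo (i + 1) * alpha ^ i ≤ 2 * Sconst := by
      calc _ ≤ 2 * eps0 * (rho * Sconst) := mul_le_mul_of_nonneg_left hCle (by positivity)
        _ = 2 * Sconst := by rw [heps0]; field_simp
    linarith [Real.sqrt_le_sqrt this]
  have hRtle : RhatTil ≤ RhatLam + 23 * w * D :=
    Rt_bound (F := fun x => f x + h x) hgp hD1 hgd0 heps (by linarith) hx0d hdiam hd hdmax hdt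
      hdtmax hRl hRt hgdlow
  have hRle : R ≤ 23 * wconst ^ 2 * (RhatLam + D) := by
    have hW := one_le_wconst
    have a1 : 23 * w * D ≤ 23 * wconst * D := by gcongr
    have a2 : RhatLam ≤ 23 * wconst * RhatLam := by
      exact le_mul_of_one_le_left (by linarith) (by linarith)
    calc R ≤ (23 * wconst * (RhatLam + D)) * wconst := by
          rw [hRdef]; exact mul_le_mul (by linarith) hwle (by linarith) (by positivity)
      _ = _ := by ring
  -- logs
  obtain ⟨l, hldef⟩ : ∃ l, l = 1 + |Real.log D| + |Real.log Lf| + |Real.log ‖A‖| +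
                |Real.log eps| + |Real.log (1 - alpha)| + |Real.log RhatLam| := ⟨_, rfl⟩
  rw [← hldef]
  have l1 := abs_nonneg (Real.log D)
  have l2 := abs_nonneg (Real.log Lf)
  have l3 := abs_nonneg (Real.log ‖A‖)
  have l4 := abs_nonneg (Real.log eps)
  have l5 := abs_nonneg (Real.log (1 - alpha))
  have l6 := abs_nonneg (Real.log RhatLam)
  have hl : 1 ≤ l := by linarith
  have bD := (le_exp_of_abs_log hD0 (show _ ≤ l by linarith)).1
  have bL := (le_exp_of_abs_log hLf (show _ ≤ l by linarith)).2
  have ba := (le_exp_of_abs_log hA0 (show _ ≤ l by linarith)).1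
  have be := (le_exp_of_abs_log heps (show _ ≤ l by linarith)).2
  have bR := (le_exp_of_abs_log (show 0 < RhatLam by linarith) (show _ ≤ l by linarith)).1
  have hinv := rho_inv hLf hA0 heps hrho ba be bL
  -- inner iterations
  obtain ⟨X, hX⟩ : ∃ X, X = Real.sqrt (D * Lf) / Real.sqrt eps := ⟨_, rfl⟩
  obtain ⟨Y, hY⟩ : ∃ Y, Y = Real.sqrt (D + RhatLam) * ‖A‖ / Real.sqrt (Lf * eps) := ⟨_, rfl⟩
  have hX0 : 0 ≤ X := by rw [hX]; positivity
  have hY0 : 0 ≤ Y := by rw [hY]; positivity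
  have hJ : ∀ k, (J k : ℝ) ≤ 13 * l * (1 + 6 * X) + 1 := by
    intro k
    have hLe : Lf + rho * ‖A‖ ^ 2 = 2 * Lf := by rw [hrho]; field_simp; norm_num
    have c0 : 0 ≤ epsFALM eps0 alpha (1 / 4) rho eps k / (4 * D ^ 2) :=
      div_nonneg (hek0 k).le (by positivity)
    obtain ⟨s1, s2⟩ := s_bound (mu := gp + epsFALM eps0 alpha (1 / 4) rho eps k / (4 * D ^ 2))
      hD0 hLf heps hX hLe (by rw [← hgp]; linarith)
    have hT := inner_T (mu := gp + epsFALM eps0 alpha (1 / 4) rho eps k / (4 * D ^ 2))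
      hLf hA0 heps hD1 hrho (hek k) (by rw [hgp]) rfl hl bD ba be bL
    have := inner_J (t := 13 * l) hfc hf hLf hh hcl hlsc hne hD1 hdiam hrho0.le hgp0 (hek0 k) rfl
      rfl (sACG k) (sP k) (sGm k) (sJ k) (by linarith) hT s1 s2
    rwa [one_div_one_div] at this
  -- outer iterations
  have hLpos : 0 < Lf + rho * ‖A‖ ^ 2 := by positivity
  have hkap : ∀ k, 0 < 2 * (Lf + rho * ‖A‖ ^ 2) +
        (gp + epsFALM eps0 alpha (1 / 4) rho eps k / (4 * D ^ 2)) := by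
    intro k
    have := div_nonneg (hek0 k).le (show 0 ≤ 4 * D ^ 2 by positivity)
    linarith
  have hxP : ∀ k, xseq (k + 1) = P k (J k) := by
    intro k
    rw [sx, sGm, smul_smul, inv_mul_cancel₀ (hkap k).ne', one_smul, sub_sub_cancel]
  have hprim : ∀ k, ∃ v : Euc n, ‖v‖ ≤ 2 * ‖Gm k (J k)‖ ∧ ∀ w ∈ domh,
      f (xseq (k + 1)) + h (xseq (k + 1)) + ⟪lamseq (k + 1), A (xseq (k + 1)) - bvec⟫ +
        ⟪v - gp • (xseq (k + 1) - x0c), w - xseq (k + 1)⟫ ≤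
        f w + h w + ⟪lamseq (k + 1), A w - bvec⟫ := by
    intro k
    have hl' := slam k
    rw [hxP] at hl' ⊢
    exact primal_facts hfc hf hLf hh hrho0.le hgp0.le
      (le_add_of_nonneg_right (div_nonneg (hek0 k).le (by positivity))) rfl (sP k (J k))
      (sGm k (J k)) hl'
  have hvk : ∀ k, 2 * ‖Gm k (J k)‖ ≤ epsFALM eps0 alpha (1 / 4) rho eps k / D := by
    intro k
    have := sGle k
    have e : epsFALM eps0 alpha (1 / 4) rho eps k / D =
      2 * (epsFALM eps0 alpha (1 / 4) rho eps k / (2 * D)) := by field_simp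
    linarith
  have hxd : ∀ k, xseq (k + 1) ∈ domh := fun k => by rw [hxP]; exact (sP k (J k)).1
  obtain ⟨hq0, hqY⟩ := q_bound hD0 hLf hA0 heps (by linarith) hrho hgd0 hgdlow one_le_wconst hR1
    hRle hq hY
  have hWl := wlog_nonneg
  have hW1 := one_le_wconst
  obtain ⟨W, hW⟩ : ∃ W, W = 5 + Real.log (60 * wconst ^ 2) := ⟨_, rfl⟩
  have hW0 : 0 < W := by linarith
  obtain ⟨N, hNlo, hNhi⟩ : ∃ N : ℕ, 50 * l + W * l * (1 + 66 * wconst * Y) ≤ N ∧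
      (N : ℝ) < 50 * l + W * l * (1 + 66 * wconst * Y) + 1 :=
    ⟨_, Nat.le_ceil _, Nat.ceil_lt_add_one (by positivity)⟩
  have ha9 : alpha ≤ 9 / 10 := by
    refine hal1.trans ?_
    have : ((1 + q) ^ 2)⁻¹ ≤ 1 := inv_le_one_of_one_le₀ (one_le_pow₀ (by linarith))
    linarith
  have hWp : 0 ≤ W * l * (1 + 66 * wconst * Y) := by positivity
  have hN1 : epsFALM eps0 alpha (1 / 4) rho eps N ≤ D * eps / 2 := by
    rw [heps0]
    exact N_first halpha ha9 hrho0 heps hre hD1 hl hinv (by linarith)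
  have hN2 : R ^ 2 / 2 < Bo (N + 1) * (rho * eps ^ 2 / 3) := by
    refine N_second hq0 hrho0 heps hl one_le_wconst hR1 hRle bD bR hinv (hgr N).1 ?_
    rw [← hW]
    have : W * l * (1 + 1 / (q / 2)) ≤ W * l * (1 + 66 * wconst * Y) :=
      mul_le_mul_of_nonneg_left (by linarith) (by positivity)
    linarith
  have hterm := outer_terminate (lam := lamseq) (nu := nu) (nut := nut)
    (r := fun k => A (xseq (k + 1)) - bvec) (z := lamt) (B := Bo) (b := bo) (tau := tauo)
    (dp := fun x => dt x + gd / 2 * ‖x‖ ^ 2) (R := R)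
    hgd0 hrho0 heps hre hD1 halpha heps00 hR1 hgdup sB0 snu0 sBo hseq ?_ slam ?_ ?_ ?_ ?_ N hN1 hN2
  · obtain ⟨K, hKN, hKe, hKr⟩ := hterm
    refine ⟨K, ?_, hKr, ?_⟩
    · obtain ⟨v, hv, hsub⟩ := hprim K
      refine ⟨v - gp • (xseq (K + 1) - x0c), fun y hy => hsub y hy, ?_⟩
      have a1 : ‖gp • (xseq (K + 1) - x0c)‖ ≤ eps / 2 := by
        rw [norm_smul, Real.norm_of_nonneg hgp0.le]
        calc _ ≤ gp * D := mul_le_mul_of_nonneg_left (hdiam _ (hxd K) _ hx0d) hgp0.le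
          _ = eps / 2 := by rw [hgp]; field_simp
      have a2 : epsFALM eps0 alpha (1 / 4) rho eps K / D ≤ eps / 2 := by
        rw [div_le_iff₀ hD0]; linarith
      have a3 := norm_sub_le v (gp • (xseq (K + 1) - x0c))
      linarith [hvk K]
    · have hN3 : (N : ℝ) + 1 ≤ cconst * l * (1 + Y) := by
        unfold cconst
        rw [← hW]
        have t1 : 0 ≤ l * Y := by positivity
        have t2 : 0 ≤ W * (l * Y) := by positivity
        have t3 : 0 ≤ W * wconst * l := by positivity
        linarith
      have hfin := final_sum hKN hl hX0 hJ hN3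
      rw [← XY_id hD0 hLf heps (by linarith), ← hX, ← hY]
      refine hfin.trans (rpow_le hl ?_ (by positivity))
      have t : 0 ≤ W * wconst := by positivity
      unfold cconst
      rw [← hW]
      linarith
  · intro k
    have hBp : 0 < Bo (k + 1) := by
      rw [sBo k]; have := (hseq k).2.2.1; have := hBpos k; linarith
    rw [snut, smul_add, smul_smul, smul_smul, mul_div_cancel₀ _ hBp.ne', mul_div_cancel₀ _ hBp.ne']
  · intro k
    have htp : 0 < tauo (k + 1) := by
      rw [(hseq (k + 1)).2.1]; have := hBpos (k + 1); positivity
    have hg : 0 < 1 + gd * rho := by positivity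
    rw [snu, smul_smul, mul_inv_cancel₀ htp.ne', one_smul, slam k]
    have c1 : (bo k * gd / (1 + gd * rho)) = bo k / rho - (bo k / rho) * (1 + gd * rho)⁻¹ := by
      field_simp; ring
    have c2 : bo k = bo k / rho * rho := by field_simp
    rw [c1]
    nth_rewrite 4 [c2]
    module
  · intro k x
    obtain ⟨v, hv, hsub⟩ := hprim k
    exact dual_sup hgp0.le hD0 (hek0 k).le hdt (hxd k) hdiam (hv.trans (hvk k)) hsub x
  · intro x
    have := hdtmax x
    simpa using this
  · intro k
    have hs := hsum.sum_le_tsum (Finset.range k)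
      (fun i _ => mul_nonneg (hBpos (i + 1)) (pow_nonneg halpha i))
    have hu2 : (w - 1) ^ 2 = 2 * eps0 * ∑' i : ℕ, Bo (i + 1) * alpha ^ i := by
      rw [hw, add_sub_cancel_left, Real.sq_sqrt (by positivity)]
    have hs2 := mul_le_mul_of_nonneg_left hs heps00.le
    have hz : ‖lamt‖ ≤ RhatTil := hRt ▸ le_max_right _ _
    have hz2 := pow_le_pow_left₀ (norm_nonneg _) hz 2
    have b1 : 1 ≤ RhatTil ^ 2 := one_le_pow₀ hRt1
    have b2 : w ^ 2 - 1 ≤ RhatTil ^ 2 * (w ^ 2 - 1) :=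
      le_mul_of_one_le_left (by linarith [one_le_pow₀ hw1 (n := 2)]) b1
    have b3 : R ^ 2 = RhatTil ^ 2 * w ^ 2 := by rw [hRdef]; ring
    rw [b3]
    linarith
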